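/- Let N ≥ 1, α > 0, T > 0, u₀ ∈ C_{b,u}(ℝ^N), and suppose u ∈ C([0,T], C_{b,u}(ℝ^N)) satisfies u(t) = K(t,·) ⋆ u₀ + ∫₀ᵗ K(t-s,·) ⋆ (|u(s)|^α u(s)) ds for all 0 ≤ t ≤ T (the integral being a Bochner integral in C_{b,u}(ℝ^N), with the first term interpreted as u₀ when t = 0). Then: (i) the map t ↦ u(t) is continuously differentiable from (0,T) into C_{b,u}(ℝ^N); (ii) for each t ∈ (0,T) the function u(t,·) is twice continuously differentiable in x, with Δu(t,·) ∈ C_{b,u}(ℝ^N) and t ↦ Δu(t) continuous from (0,T) into C_{b,u}(ℝ^N); (iii) ∂_t u = Δu + |u|^α u on (0,T) × ℝ^N; (iv) moreover each first-order spatial derivative ∂_i u belongs to C¹((0,T), C_{b,u}(ℝ^N)) and every second-order spatial derivative of u belongs to C((0,T), C_{b,u}(ℝ^N)). -/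

import Mathlib

open MeasureTheory Real Set Filter BoundedContinuousFunction

/-- The Gaussian heat kernel `K(t,x) = (4πt)^{-N/2} exp(-|x|²/(4t))` on `ℝ^N`. -/
noncomputable def gaussK (N : ℕ) (t : ℝ) (x : EuclideanSpace ℝ (Fin N)) : ℝ :=
  (4 * π * t) ^ (-(N : ℝ) / 2) * Real.exp (-‖x‖ ^ 2 / (4 * t))

/-- The Laplacian of `f : ℝ^N → ℝ`, as the sum of the pure second partial derivatives. -/
noncomputable def lap (N : ℕ) (f : EuclideanSpace ℝ (Fin N) → ℝ)
    (x : EuclideanSpace ℝ (Fin N)) : ℝ :=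
  ∑ i : Fin N, iteratedFDeriv ℝ 2 f x ![EuclideanSpace.single i 1, EuclideanSpace.single i 1]

open scoped Topology

section Gauss

/-- Euclidean space. -/
abbrev EE (N : ℕ) := EuclideanSpace ℝ (Fin N)

/-- Unit time heat kernel. -/
noncomputable def GK (N : ℕ) (z : EE N) : ℝ := gaussK N 1 z

lemma GK_eq (N : ℕ) (z : EE N) :
    GK N z = (4 * π) ^ (-(N : ℝ) / 2) * Real.exp (-(1/4) * ‖z‖ ^ 2) := by
  unfold GK gaussK
  congr 2
  · ring_nf
  · ring

lemma GK_pos (N : ℕ) (z : EE N) : 0 < GK N z := by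
  rw [GK_eq]; positivity

lemma GK_cont (N : ℕ) : Continuous (GK N) := by
  have : GK N = fun z => (4 * π) ^ (-(N : ℝ) / 2) * Real.exp (-(1/4) * ‖z‖ ^ 2) := by
    ext z; exact GK_eq N z
  rw [this]; fun_prop

lemma GK_neg (N : ℕ) (z : EE N) : GK N (-z) = GK N z := by
  simp [GK_eq]

lemma integrable_gauss (N : ℕ) (b : ℝ) (hb : 0 < b) :
    Integrable (fun z : EE N => Real.exp (-b * ‖z‖ ^ 2)) := by
  have h := GaussianFourier.integrable_cexp_neg_mul_sq_norm_add (V := EE N)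
    (b := (b : ℂ)) (by simpa using hb) 0 0
  have h2 := h.norm
  refine h2.congr (Eventually.of_forall fun z => ?_)
  simp only [Complex.norm_exp]
  congr 1
  norm_cast
  simp

lemma integrable_gauss_poly (N : ℕ) (b : ℝ) (hb : 0 < b) :
    Integrable (fun z : EE N => (1 + ‖z‖) ^ 2 * Real.exp (-b * ‖z‖ ^ 2)) := by
  have h := (integrable_gauss N (b/2) (by positivity)).const_mul (2 + 4 / b)
  refine h.mono' (by fun_prop) (Eventually.of_forall fun z => ?_)
  rw [Real.norm_of_nonneg (by positivity)]
  have h1 : (1 + ‖z‖) ^ 2 ≤ (2 + 4 / b) * Real.exp (b/2 * ‖z‖^2) := by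
    have e1 : 1 + b/2 * ‖z‖^2 ≤ Real.exp (b/2 * ‖z‖^2) := by
      have := Real.add_one_le_exp (b/2 * ‖z‖^2); linarith
    have e2 : (1 + ‖z‖) ^ 2 ≤ 2 + 2 * ‖z‖^2 := by nlinarith [sq_nonneg (1 - ‖z‖)]
    have e3 : (2 + 4 / b) * (1 + b/2 * ‖z‖^2) = 2 + 4/b + b * ‖z‖^2 + 2 * ‖z‖^2 := by
      field_simp; ring
    have e4 : (2 + 4 / b) * (1 + b/2 * ‖z‖^2) ≤ (2 + 4 / b) * Real.exp (b/2 * ‖z‖^2) := by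
      gcongr
    have : 0 ≤ 4/b + b * ‖z‖^2 := by positivity
    linarith
  calc (1 + ‖z‖) ^ 2 * Real.exp (-b * ‖z‖ ^ 2)
      ≤ ((2 + 4 / b) * Real.exp (b/2 * ‖z‖^2)) * Real.exp (-b * ‖z‖ ^ 2) := by gcongr
    _ = (2 + 4 / b) * Real.exp (-(b/2) * ‖z‖ ^ 2) := by
      rw [mul_assoc, ← Real.exp_add]; ring_nf

lemma integrable_GK_poly (N : ℕ) : Integrable (fun z : EE N => (1 + ‖z‖) ^ 2 * GK N z) := by
  refine ((integrable_gauss_poly N (1/4) (by norm_num)).const_mul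
    ((4 * π) ^ (-(N : ℝ) / 2))).congr (Eventually.of_forall fun z => ?_)
  simp only [GK_eq]; ring

lemma integrable_GK (N : ℕ) : Integrable (GK N) := by
  refine (integrable_GK_poly N).mono' (GK_cont N).aestronglyMeasurable
    (Eventually.of_forall fun z => ?_)
  rw [Real.norm_of_nonneg (GK_pos N z).le]
  have := GK_pos N z
  have h : 1 ≤ (1 + ‖z‖) ^ 2 := by nlinarith [norm_nonneg z]
  nlinarith

lemma integral_GK (N : ℕ) : ∫ z, GK N z = 1 := by
  simp_rw [GK_eq]
  rw [integral_const_mul, GaussianFourier.integral_rexp_neg_mul_sq_norm (by norm_num)]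
  simp only [finrank_euclideanSpace, Fintype.card_fin]
  rw [show π / (1/4) = 4 * π by ring, ← Real.rpow_add (by positivity)]
  rw [show -(N:ℝ)/2 + N/2 = 0 by ring, Real.rpow_zero]

/-- The Gaussian measure. -/
noncomputable def gam (N : ℕ) : Measure (EE N) :=
  (volume : Measure (EE N)).withDensity (fun z => ENNReal.ofReal (GK N z))

instance (N : ℕ) : IsProbabilityMeasure (gam N) := by
  constructor
  rw [gam, withDensity_apply _ MeasurableSet.univ, setLIntegral_univ,
    ← ofReal_integral_eq_lintegral_ofReal (integrable_GK N)
      (Eventually.of_forall fun z => (GK_pos N z).le), integral_GK]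
  simp

lemma integral_gam (N : ℕ) {X : Type*} [NormedAddCommGroup X] [NormedSpace ℝ X] (g : EE N → X) :
    ∫ z, g z ∂(gam N) = ∫ z, GK N z • g z := by
  rw [gam, integral_withDensity_eq_integral_toReal_smul₀ (by
    exact (GK_cont N).measurable.ennreal_ofReal.aemeasurable) (by simp)]
  refine integral_congr_ae (Eventually.of_forall fun z => ?_)
  simp [ENNReal.toReal_ofReal (GK_pos N z).le]

lemma charFun_gam (N : ℕ) (t : EE N) : charFun (gam N) t = Complex.exp (-(‖t‖ : ℂ) ^ 2) := by
  rw [charFun_apply, integral_gam]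
  have h := GaussianFourier.integral_cexp_neg_mul_sq_norm_add (V := EE N)
    (b := ((1/4 : ℝ) : ℂ)) (by rw [Complex.ofReal_re]; norm_num) Complex.I t
  have h0 := GaussianFourier.integral_cexp_neg_mul_sq_norm_add (V := EE N)
    (b := ((1/4 : ℝ) : ℂ)) (by rw [Complex.ofReal_re]; norm_num) 0 t
  have h1 : ∫ z : EE N, Complex.exp (-((1/4:ℝ):ℂ) * ‖z‖^2 + 0 * (inner ℝ t z : ℝ)) =
      (((4 * π) ^ (-(N : ℝ) / 2) : ℝ) : ℂ)⁻¹ := by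
    have e := integral_GK N
    simp_rw [GK_eq, integral_const_mul] at e
    have e' : ∫ z : EE N, Real.exp (-(1/4) * ‖z‖ ^ 2) = ((4 * π) ^ (-(N : ℝ) / 2))⁻¹ :=
      (eq_inv_of_mul_eq_one_right e)
    rw [← Complex.ofReal_inv, ← e', ← integral_complex_ofReal]
    congr 1; ext z; push_cast; simp
  have h2 : ∀ z : EE N, GK N z • Complex.exp ((inner ℝ z t : ℝ) * Complex.I) =
      (((4 * π) ^ (-(N : ℝ) / 2) : ℝ) : ℂ) *
        Complex.exp (-((1/4:ℝ):ℂ) * ‖z‖^2 + Complex.I * (inner ℝ t z : ℝ)) := by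
    intro z
    rw [GK_eq, Complex.real_smul, Complex.ofReal_mul, mul_assoc, Complex.exp_add,
      real_inner_comm, mul_comm Complex.I]
    congr 2
    push_cast; rfl
  simp_rw [h2]
  rw [integral_const_mul, h]
  rw [h1] at h0
  have h3 : (((4 * π) ^ (-(N : ℝ) / 2) : ℝ) : ℂ) ≠ 0 := by
    norm_cast; positivity
  simp only [ne_eq, OfNat.ofNat_ne_zero, not_false_eq_true, zero_pow, zero_mul, zero_div,
    Complex.exp_zero, mul_one] at h0
  rw [← h0, ← mul_assoc, mul_inv_cancel₀ h3, one_mul]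
  congr 1
  rw [Complex.I_sq]; push_cast; ring

lemma gam_conv (N : ℕ) (r s : ℝ) (hr : 0 ≤ r) (hs : 0 ≤ s) :
    Measure.conv ((gam N).map (fun z => √r • z)) ((gam N).map (fun z => √s • z)) =
      (gam N).map (fun z => √(r + s) • z) := by
  have : ∀ c : ℝ, IsProbabilityMeasure ((gam N).map (fun z => c • z)) := fun c =>
    Measure.isProbabilityMeasure_map (by fun_prop)
  apply Measure.ext_of_charFun
  ext t
  rw [charFun_conv, charFun_map_smul, charFun_map_smul, charFun_map_smul, charFun_gam,
    charFun_gam, charFun_gam, ← Complex.exp_add]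
  congr 1
  simp only [norm_smul, Real.norm_eq_abs, abs_of_nonneg (Real.sqrt_nonneg _)]
  norm_cast
  simp only [mul_pow, Real.sq_sqrt hr, Real.sq_sqrt hs, Real.sq_sqrt (add_nonneg hr hs)]
  ring

end Gauss

section Weights

variable {N : ℕ}

/-- Weight for the gradient of the heat semigroup. -/
noncomputable def Wt (v z : EE N) : ℝ := inner ℝ z v / 2 * GK N z

lemma Wt_cont (v : EE N) : Continuous (Wt v) := by
  have := GK_cont N
  unfold Wt; fun_prop

lemma abs_Wt_le (v z : EE N) : |Wt v z| ≤ ‖v‖ * ((1 + ‖z‖) * GK N z) := by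
  have h := abs_real_inner_le_norm z v
  have hp := GK_pos N z
  rw [Wt, abs_mul, abs_div, abs_of_pos hp, abs_two]
  have : |inner ℝ z v| / 2 ≤ ‖v‖ * (1 + ‖z‖) := by
    nlinarith [norm_nonneg z, norm_nonneg v, abs_nonneg (inner ℝ z v)]
  calc |inner ℝ z v| / 2 * GK N z ≤ (‖v‖ * (1 + ‖z‖)) * GK N z := by gcongr
    _ = _ := by ring

lemma integrable_Wt_poly (v : EE N) : Integrable (fun z => (1 + ‖z‖) * |Wt v z|) := by
  refine ((integrable_GK_poly N).const_mul ‖v‖).mono' ?_ (Eventually.of_forall fun z => ?_)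
  · have := Wt_cont v
    exact Continuous.aestronglyMeasurable (by fun_prop)
  · rw [Real.norm_of_nonneg (by positivity)]
    calc (1 + ‖z‖) * |Wt v z| ≤ (1 + ‖z‖) * (‖v‖ * ((1 + ‖z‖) * GK N z)) := by
          gcongr; exact abs_Wt_le v z
      _ = _ := by ring

lemma integrable_Wt (v : EE N) : Integrable (Wt v) := by
  refine (integrable_Wt_poly v).mono' (Wt_cont v).aestronglyMeasurable
    (Eventually.of_forall fun z => ?_)
  rw [Real.norm_eq_abs]
  nlinarith [norm_nonneg z, abs_nonneg (Wt v z)]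

lemma integral_Wt (v : EE N) : ∫ z, Wt v z = 0 := by
  have h : ∫ z, Wt v (-z) = ∫ z, Wt v z := integral_neg_eq_self _ _
  have h2 : ∀ z, Wt v (-z) = - Wt v z := by
    intro z; simp [Wt, GK_neg, inner_neg_left]; ring
  simp_rw [h2, integral_neg] at h
  linarith

lemma hasDerivAt_GK (z v : EE N) (c s : ℝ) :
    HasDerivAt (fun s : ℝ => GK N (z - (c * s) • v)) (c * Wt v (z - (c * s) • v)) s := by
  simp_rw [Wt, GK_eq]
  have h1 : HasDerivAt (fun s : ℝ => z - (c * s) • v) (-(c • v)) s := by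
    have : HasDerivAt (fun s : ℝ => (c * s)) c s := by
      simpa using (hasDerivAt_id s).const_mul c
    exact (this.smul_const v).const_sub z
  have h2 := h1.norm_sq
  have h3 := ((h2.const_mul (-(1/4))).exp).const_mul ((4 * π) ^ (-(N : ℝ) / 2))
  refine h3.congr_deriv ?_
  simp only [inner_neg_right, inner_smul_right]
  ring

lemma GK_shift_le (z y : EE N) (R : ℝ) (hy : ‖y‖ ≤ R) :
    GK N (z - y) ≤ (4 * π) ^ (-(N : ℝ) / 2) * Real.exp (R ^ 2 / 4) *
      Real.exp (-(1/8) * ‖z‖ ^ 2) := by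
  rw [GK_eq, mul_assoc, ← Real.exp_add]
  gcongr
  have h1 : ‖z‖ ≤ ‖z - y‖ + ‖y‖ := by simpa using norm_add_le (z - y) y
  have h0 := norm_nonneg z
  have h2 : ‖z‖^2 ≤ 2 * ‖z - y‖^2 + 2 * R^2 := by
    nlinarith [sq_nonneg (‖z-y‖ - ‖y‖), norm_nonneg y, norm_nonneg (z-y)]
  linarith

lemma Wt_shift_le (z y v : EE N) (R : ℝ) (hy : ‖y‖ ≤ R) :
    |Wt v (z - y)| ≤ (‖v‖ * (1 + R) * ((4 * π) ^ (-(N : ℝ) / 2) * Real.exp (R ^ 2 / 4))) *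
      ((1 + ‖z‖) ^ 2 * Real.exp (-(1/8) * ‖z‖ ^ 2)) := by
  have hR : 0 ≤ R := (norm_nonneg y).trans hy
  have h1 : ‖z - y‖ ≤ ‖z‖ + R := (norm_sub_le z y).trans (by linarith)
  have h2 : 1 + ‖z - y‖ ≤ (1 + R) * (1 + ‖z‖) ^ 2 := by
    have hz := norm_nonneg z
    have : (1 + ‖z‖) ≤ (1 + ‖z‖)^2 := by nlinarith
    have : (1 + R) * (1 + ‖z‖) ≤ (1 + R) * (1 + ‖z‖) ^ 2 := by gcongr
    nlinarith
  have hp := (GK_pos N (z - y)).le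
  calc |Wt v (z - y)| ≤ ‖v‖ * ((1 + ‖z - y‖) * GK N (z - y)) := abs_Wt_le _ _
    _ ≤ ‖v‖ * (((1 + R) * (1 + ‖z‖) ^ 2) * ((4 * π) ^ (-(N : ℝ) / 2) * Real.exp (R ^ 2 / 4) *
      Real.exp (-(1/8) * ‖z‖ ^ 2))) := by
        gcongr
        exact GK_shift_le z y R hy
    _ = _ := by ring

end Weights

/-- A strongly continuous contractive representation of the translation group. -/
structure TG (N : ℕ) (X : Type*) [NormedAddCommGroup X] [NormedSpace ℝ X] where
  τ : EE N → X →L[ℝ] X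
  zero : ∀ f, τ 0 f = f
  add : ∀ a b f, τ (a + b) f = τ a (τ b f)
  norm_le : ∀ a f, ‖τ a f‖ ≤ ‖f‖
  cont : ∀ f, Continuous fun a => τ a f

namespace TG

variable {N : ℕ} {X : Type*} [NormedAddCommGroup X] [NormedSpace ℝ X] (A : TG N X)

lemma comm (a b : EE N) (f : X) : A.τ a (A.τ b f) = A.τ b (A.τ a f) := by
  rw [← A.add, ← A.add, add_comm]

lemma jcont : Continuous fun p : EE N × X => A.τ p.1 p.2 := by
  rw [continuous_iff_continuousAt]
  rintro ⟨b, g⟩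
  have h1 : Tendsto (fun p : EE N × X => ‖p.2 - g‖ + ‖A.τ p.1 g - A.τ b g‖) (𝓝 (b, g)) (𝓝 0) := by
    have hc : Continuous (fun p : EE N × X => ‖p.2 - g‖ + ‖A.τ p.1 g - A.τ b g‖) := by
      have := (A.cont g).comp (continuous_fst (X := EE N) (Y := X))
      simp only [Function.comp_def] at this
      fun_prop
    simpa using hc.tendsto (b, g)
  refine tendsto_iff_norm_sub_tendsto_zero.2 (squeeze_zero (fun _ => norm_nonneg _) ?_ h1)
  rintro ⟨a, f⟩
  have : A.τ a f - A.τ b g = A.τ a (f - g) + (A.τ a g - A.τ b g) := by simp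
  simp only [this]
  exact (norm_add_le _ _).trans (by gcongr; exact A.norm_le _ _)

lemma cont_comp {Y : Type*} [TopologicalSpace Y] {a : Y → EE N} {f : Y → X} (ha : Continuous a)
    (hf : Continuous f) : Continuous fun y => A.τ (a y) (f y) :=
  A.jcont.comp (ha.prodMk hf)

/-- Directional derivative. -/
def HasD (v : EE N) (f g : X) : Prop := HasDerivAt (fun s : ℝ => A.τ (s • v) f) g 0

variable {A}

lemma HasD.at {v : EE N} {f g : X} (h : A.HasD v f g) (s₀ : ℝ) :
    HasDerivAt (fun s : ℝ => A.τ (s • v) f) (A.τ (s₀ • v) g) s₀ := by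
  have h1 : HasDerivAt (fun s : ℝ => A.τ ((s - s₀) • v) f) g s₀ := by
    have h2 : HasDerivAt (fun s : ℝ => A.τ (s • v) f) g (s₀ - s₀) := by rw [sub_self]; exact h
    simpa using h2.comp_sub_const s₀ s₀
  have h2 := (A.τ (s₀ • v)).hasFDerivAt.comp_hasDerivAt s₀ h1
  refine h2.congr_of_eventuallyEq (Eventually.of_forall fun s => ?_)
  simp only [Function.comp]
  rw [← A.add, ← add_smul]; congr 2; ring_nf

lemma HasD.unique {v : EE N} {f g g' : X} (h : A.HasD v f g) (h' : A.HasD v f g') : g = g' :=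
  HasDerivAt.unique h h'

lemma HasD.clm {v : EE N} {f g : X} (h : A.HasD v f g) (L : X →L[ℝ] X)
    (hL : ∀ a f, A.τ a (L f) = L (A.τ a f)) : A.HasD v (L f) (L g) := by
  unfold HasD at *
  simp_rw [hL]
  exact L.hasFDerivAt.comp_hasDerivAt 0 h

lemma HasD.add {v : EE N} {f g f' g' : X} (h : A.HasD v f g) (h' : A.HasD v f' g') :
    A.HasD v (f + f') (g + g') := by
  unfold HasD at *
  simp_rw [map_add]
  exact HasDerivAt.add h h'

lemma HasD.zero_dir (f : X) : A.HasD 0 f 0 := by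
  unfold HasD
  simp only [smul_zero]
  exact hasDerivAt_const _ _

lemma HasD.smul_dir {v : EE N} {f g : X} (h : A.HasD v f g) (c : ℝ) : A.HasD (c • v) f (c • g) := by
  unfold HasD
  have h1 : HasDerivAt (fun s : ℝ => s * c) c 0 := by simpa using (hasDerivAt_id (0:ℝ)).mul_const c
  have h2 : HasDerivAt (fun s : ℝ => A.τ (s • v) f) g ((0:ℝ) * c) := by rw [zero_mul]; exact h
  have h3 := h2.scomp (0:ℝ) h1
  refine h3.congr_of_eventuallyEq (Eventually.of_forall fun s => ?_)
  simp [Function.comp, smul_smul]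

lemma HasD.add_dir {v w : EE N} {f g k : X} (h : A.HasD v f g) (h' : A.HasD w f k) :
    A.HasD (v + w) f (g + k) := by
  unfold HasD at *
  rw [hasDerivAt_iff_tendsto_slope_zero] at *
  simp only [zero_add, zero_smul, A.zero] at *
  have h1 : Tendsto (fun t : ℝ => A.τ (t • v) (t⁻¹ • (A.τ (t • w) f - f))) (𝓝[≠] 0) (𝓝 k) := by
    have hc := A.jcont.tendsto ((0 : EE N), k)
    simp only [A.zero] at hc
    have ht : Tendsto (fun t : ℝ => t • v) (𝓝[≠] 0) (𝓝 0) := by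
      have : Tendsto (fun t : ℝ => t • v) (𝓝 0) (𝓝 ((0:ℝ) • v)) :=
        (continuous_id.smul continuous_const).tendsto 0
      rw [zero_smul] at this
      exact this.mono_left nhdsWithin_le_nhds
    exact hc.comp (ht.prodMk_nhds h')
  refine (h.add h1).congr fun t => ?_
  rw [smul_add, A.add, map_smul, ← smul_add, map_sub]
  congr 1; abel

lemma HasD.sum_dir {ι : Type*} (s : Finset ι) {e : ι → EE N} {f : X} {g : ι → X}
    (h : ∀ i ∈ s, A.HasD (e i) f (g i)) : A.HasD (∑ i ∈ s, e i) f (∑ i ∈ s, g i) := by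
  classical
  induction s using Finset.induction_on with
  | empty => simpa using HasD.zero_dir f
  | insert a s ha ih =>
    rw [Finset.sum_insert ha, Finset.sum_insert ha]
    exact (h a (Finset.mem_insert_self _ _)).add_dir
      (ih fun i hi => h i (Finset.mem_insert_of_mem hi))

lemma single_sum (v : EE N) : ∑ i, v i • (EuclideanSpace.single i (1:ℝ) : EE N) = v := by
  ext j
  simp [Finset.sum_apply, Pi.single_apply]

lemma HasD.all_dir {f : X} {g : Fin N → X}
    (h : ∀ i, A.HasD (EuclideanSpace.single i (1:ℝ)) f (g i)) (v : EE N) :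
    A.HasD v f (∑ i, v i • g i) := by
  have := HasD.sum_dir (A := A) Finset.univ (e := fun i => v i • (EuclideanSpace.single i (1:ℝ) : EE N))
    (f := f) (g := fun i => v i • g i) (fun i _ => (h i).smul_dir (v i))
  rwa [single_sum] at this

lemma HasD.norm_sub_le {v : EE N} {f g : X} (h : A.HasD v f g) : ‖A.τ v f - f‖ ≤ ‖g‖ := by
  have := norm_image_sub_le_of_norm_deriv_le_segment_01' (f := fun s : ℝ => A.τ (s • v) f)
    (f' := fun s => A.τ (s • v) g) (C := ‖g‖) (fun x _ => (h.at x).hasDerivWithinAt)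
    (fun x _ => A.norm_le _ _)
  simpa [A.zero] using this

lemma HasD.lip {f : X} {g : Fin N → X}
    (h : ∀ i, A.HasD (EuclideanSpace.single i (1:ℝ)) f (g i)) (v : EE N) :
    ‖A.τ v f - f‖ ≤ (∑ i, ‖g i‖) * ‖v‖ := by
  refine (HasD.all_dir h v).norm_sub_le.trans ((norm_sum_le _ _).trans ?_)
  rw [Finset.sum_mul]
  refine Finset.sum_le_sum fun i _ => ?_
  rw [norm_smul, mul_comm]
  gcongr
  exact PiLp.norm_apply_le v i

end TG

namespace TG

variable {N : ℕ} {X : Type*} [NormedAddCommGroup X] [NormedSpace ℝ X] (A : TG N X)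

lemma integrableP {w : EE N → ℝ} (hw : Integrable w) (r : ℝ) (f : X) :
    Integrable (fun z => w z • A.τ (r • z) f) := by
  refine (hw.norm.mul_const ‖f‖).mono' ?_ (Eventually.of_forall fun z => ?_)
  · exact hw.aestronglyMeasurable.smul
      ((A.cont_comp (by fun_prop) continuous_const).aestronglyMeasurable)
  · rw [norm_smul]; gcongr; exact A.norm_le _ _

/-- The weighted Gaussian averages. -/
noncomputable def P (w : EE N → ℝ) (hw : Integrable w) (r : ℝ) : X →L[ℝ] X :=
  LinearMap.mkContinuous
    { toFun := fun f => ∫ z, w z • A.τ (√r • z) f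
      map_add' := fun f g => by
        simp only [map_add, smul_add]
        exact integral_add (A.integrableP hw _ f) (A.integrableP hw _ g)
      map_smul' := fun c f => by
        simp only [map_smul, smul_comm _ c, integral_smul, RingHom.id_apply] }
    (∫ z, |w z|) (fun f => by
      simp only [LinearMap.coe_mk, AddHom.coe_mk]
      rw [← integral_mul_const]
      refine norm_integral_le_of_norm_le (hw.norm.mul_const _) (Eventually.of_forall fun z => ?_)
      rw [norm_smul, Real.norm_eq_abs]; gcongr; exact A.norm_le _ _)

lemma P_apply (w : EE N → ℝ) (hw : Integrable w) (r : ℝ) (f : X) :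
    A.P w hw r f = ∫ z, w z • A.τ (√r • z) f := rfl

lemma norm_P_le (w : EE N → ℝ) (hw : Integrable w) (r : ℝ) (f : X) :
    ‖A.P w hw r f‖ ≤ (∫ z, |w z|) * ‖f‖ := by
  rw [P_apply, ← integral_mul_const]
  refine norm_integral_le_of_norm_le (hw.norm.mul_const _) (Eventually.of_forall fun z => ?_)
  rw [norm_smul, Real.norm_eq_abs]; gcongr; exact A.norm_le _ _

lemma P_cont_comp (w : EE N → ℝ) (hw : Integrable w) {Y : Type*} [TopologicalSpace Y]
    [FirstCountableTopology Y] {r : Y → ℝ} {f : Y → X} {y₀ : Y} (hr : ContinuousAt r y₀)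
    (hf : ContinuousAt f y₀) : ContinuousAt (fun y => A.P w hw (r y) (f y)) y₀ := by
  simp_rw [P_apply]
  refine continuousAt_of_dominated (bound := fun z => |w z| * (‖f y₀‖ + 1)) ?_ ?_ ?_ ?_
  · exact Eventually.of_forall fun y => (A.integrableP hw _ _).aestronglyMeasurable
  · have : ∀ᶠ y in 𝓝 y₀, ‖f y‖ < ‖f y₀‖ + 1 := hf.norm.eventually (gt_mem_nhds (by linarith))
    filter_upwards [this] with y hy
    refine Eventually.of_forall fun z => ?_
    rw [norm_smul, Real.norm_eq_abs]; gcongr; exact (A.norm_le _ _).trans hy.le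
  · exact hw.norm.mul_const _
  · refine Eventually.of_forall fun z => ?_
    refine continuousAt_const.smul ?_
    have h1 : ContinuousAt (fun y => (√(r y) • z, f y)) y₀ :=
      (hr.sqrt.smul continuousAt_const).prodMk hf
    exact ContinuousAt.comp (g := fun p : EE N × X => A.τ p.1 p.2) A.jcont.continuousAt h1

variable [CompleteSpace X]

lemma P_comm (w : EE N → ℝ) (hw : Integrable w) (r : ℝ) (a : EE N) (f : X) :
    A.τ a (A.P w hw r f) = A.P w hw r (A.τ a f) := by
  rw [P_apply, P_apply, ← ContinuousLinearMap.integral_comp_comm _ (A.integrableP hw _ f)]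
  simp only [map_smul]
  simp_rw [A.comm a]

/-- The heat semigroup. -/
noncomputable def S (r : ℝ) : X →L[ℝ] X := A.P (GK N) (integrable_GK N) r

/-- The gradient of the heat semigroup. -/
noncomputable def D (v : EE N) (r : ℝ) : X →L[ℝ] X := (√r)⁻¹ • A.P (Wt v) (integrable_Wt v) r

lemma S_apply (r : ℝ) (f : X) : A.S r f = ∫ z, GK N z • A.τ (√r • z) f := rfl

lemma D_apply (v : EE N) (r : ℝ) (f : X) :
    A.D v r f = (√r)⁻¹ • ∫ z, Wt v z • A.τ (√r • z) f := rfl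

lemma norm_S_le (r : ℝ) (f : X) : ‖A.S r f‖ ≤ ‖f‖ := by
  have := A.norm_P_le (GK N) (integrable_GK N) r f
  simp_rw [abs_of_pos (GK_pos N _), integral_GK, one_mul] at this
  exact this

lemma S_cont_comp {Y : Type*} [TopologicalSpace Y] [FirstCountableTopology Y] {r : Y → ℝ}
    {f : Y → X} (hr : Continuous r) (hf : Continuous f) :
    Continuous (fun y => A.S (r y) (f y)) :=
  continuous_iff_continuousAt.2 fun _ => A.P_cont_comp _ _ hr.continuousAt hf.continuousAt

lemma S_comm (r : ℝ) (a : EE N) (f : X) : A.τ a (A.S r f) = A.S r (A.τ a f) := A.P_comm _ _ _ _ _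

lemma D_comm (v : EE N) (r : ℝ) (a : EE N) (f : X) : A.τ a (A.D v r f) = A.D v r (A.τ a f) := by
  simp only [D, _root_.smul_apply, map_smul, A.P_comm]

lemma S_zero (r : ℝ) (hr : r ≤ 0) (f : X) : A.S r f = f := by
  rw [S_apply, Real.sqrt_eq_zero_of_nonpos hr]
  simp [A.zero, integral_smul_const, integral_GK]

lemma S_add (r s : ℝ) (hr : 0 ≤ r) (hs : 0 ≤ s) (f : X) : A.S r (A.S s f) = A.S (r + s) f := by
  have hrep : ∀ c : ℝ, ∀ f : X, ∫ z, GK N z • A.τ (c • z) f =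
      ∫ y, A.τ y f ∂((gam N).map (fun z => c • z)) := by
    intro c f
    rw [integral_map (by fun_prop) ((A.cont f).aestronglyMeasurable), integral_gam]
  have : ∀ c : ℝ, IsProbabilityMeasure ((gam N).map (fun z => c • z)) := fun c =>
    Measure.isProbabilityMeasure_map (by fun_prop)
  have hIntg : ∀ (μ : Measure (EE N)) [IsProbabilityMeasure μ] (f : X),
      Integrable (fun y => A.τ y f) μ := fun μ _ f =>
    (integrable_const ‖f‖).mono' ((A.cont f).aestronglyMeasurable)
      (Eventually.of_forall fun y => A.norm_le _ _)
  simp_rw [S_apply, hrep]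
  rw [← gam_conv N r s hr hs, integral_conv (hIntg _ f)]
  refine integral_congr_ae (Eventually.of_forall fun y => ?_)
  simp only
  rw [← ContinuousLinearMap.integral_comp_comm _ (hIntg _ f)]
  simp_rw [A.add]

lemma norm_D_le (v : EE N) (r : ℝ) (f : X) : ‖A.D v r f‖ ≤ (√r)⁻¹ * (∫ z, |Wt v z|) * ‖f‖ := by
  rw [D, _root_.smul_apply, norm_smul, mul_assoc,
    Real.norm_of_nonneg (by positivity)]
  gcongr
  exact A.norm_P_le _ _ _ _

lemma D_cont_comp (v : EE N) {Y : Type*} [TopologicalSpace Y] [FirstCountableTopology Y]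
    {r : Y → ℝ} {f : Y → X} {y₀ : Y} (hr : ContinuousAt r y₀) (h0 : 0 < r y₀)
    (hf : ContinuousAt f y₀) : ContinuousAt (fun y => A.D v (r y) (f y)) y₀ := by
  simp only [D, _root_.smul_apply]
  exact (hr.sqrt.inv₀ (Real.sqrt_pos.2 h0).ne').smul (A.P_cont_comp _ _ hr hf)

lemma hasD_S (v : EE N) (r : ℝ) (hr : 0 < r) (f : X) : A.HasD v (A.S r f) (A.D v r f) := by
  set c : ℝ := (√r)⁻¹ with hc
  have hsr : 0 < √r := Real.sqrt_pos.2 hr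
  have hrw : ∀ s : ℝ, A.τ (s • v) (A.S r f) =
      ∫ z, GK N (z - (c * s) • v) • A.τ (√r • z) f := by
    intro s
    rw [S_comm, S_apply, ← integral_sub_right_eq_self _ ((c * s) • v)]
    refine integral_congr_ae (Eventually.of_forall fun z => ?_)
    simp only
    rw [← A.add]
    congr 3
    rw [smul_sub, smul_smul, ← mul_assoc, hc, mul_inv_cancel₀ hsr.ne', one_mul]
    abel
  unfold HasD
  simp_rw [hrw]
  have key := (hasDerivAt_integral_of_dominated_loc_of_deriv_le (𝕜 := ℝ) (μ := volume)
    (F := fun (s : ℝ) (z : EE N) => GK N (z - (c * s) • v) • A.τ (√r • z) f)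
    (F' := fun (s : ℝ) (z : EE N) => (c * Wt v (z - (c * s) • v)) • A.τ (√r • z) f)
    (x₀ := (0:ℝ)) (s := Metric.ball 0 1)
    (bound := fun z => c * ((‖v‖ * (1 + c * ‖v‖) * ((4 * π) ^ (-(N : ℝ) / 2) *
      Real.exp ((c * ‖v‖) ^ 2 / 4))) *
      ((1 + ‖z‖) ^ 2 * Real.exp (-(1/8) * ‖z‖ ^ 2))) * ‖f‖)
    (Metric.ball_mem_nhds _ one_pos) ?_ ?_ ?_ ?_ ?_ ?_).2
  · simp only [mul_zero, zero_smul, sub_zero] at key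
    rw [D_apply, ← integral_smul]
    simpa only [smul_smul] using key
  · refine Eventually.of_forall fun s => Continuous.aestronglyMeasurable ?_
    have h1 := A.cont_comp (a := fun z : EE N => √r • z) (by fun_prop)
      (continuous_const (y := f))
    have h2 := GK_cont N
    fun_prop
  · simp only [mul_zero, zero_smul, sub_zero]
    exact A.integrableP (integrable_GK N) _ _
  · refine Continuous.aestronglyMeasurable ?_
    have h1 := A.cont_comp (a := fun z : EE N => √r • z) (by fun_prop)
      (continuous_const (y := f))
    have h2 := Wt_cont v
    fun_prop
  · refine Eventually.of_forall fun z s hs => ?_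
    have hcp : 0 < c := inv_pos.2 hsr
    rw [norm_smul, norm_mul, Real.norm_of_nonneg hcp.le]
    gcongr
    · refine Wt_shift_le z _ v (c * ‖v‖) ?_
      rw [norm_smul, norm_mul, Real.norm_of_nonneg hcp.le]
      have : ‖s‖ ≤ 1 := by simpa using (Metric.mem_ball.1 hs).le
      nlinarith [mul_nonneg hcp.le (norm_nonneg v)]
    · exact A.norm_le _ _
  · exact (((integrable_gauss_poly N (1/8) (by norm_num)).const_mul _).const_mul _).mul_const _
  · refine Eventually.of_forall fun z s _ => ?_
    exact (hasDerivAt_GK z v c s).smul_const _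

lemma D_eq_S (v : EE N) (r : ℝ) (hr : 0 < r) {f g : X} (h : A.HasD v f g) :
    A.D v r f = A.S r g :=
  (A.hasD_S v r hr f).unique (h.clm (A.S r) (fun _ _ => A.S_comm _ _ _))

lemma D_split (v : EE N) (r : ℝ) (hr : 0 < r) (f : X) :
    A.D v r f = A.S (r/2) (A.D v (r/2) f) := by
  have h2 : 0 < r / 2 := by positivity
  have h1 := A.hasD_S v r hr f
  have h3 := (A.hasD_S v (r/2) h2 f).clm (A.S (r/2)) (fun _ _ => A.S_comm _ _ _)
  rw [A.S_add _ _ h2.le h2.le, add_halves] at h3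
  exact h1.unique h3

/-- Second derivatives of the heat semigroup. -/
lemma hasD_D (v w : EE N) (r : ℝ) (hr : 0 < r) (f : X) :
    A.HasD v (A.D w r f) (A.D v (r/2) (A.D w (r/2) f)) := by
  rw [A.D_split w r hr]
  exact A.hasD_S _ _ (by positivity) _

lemma norm_D_le_holder (v : EE N) (r : ℝ) (f : X) (C β : ℝ) (hβ : 0 < β) (hβ1 : β ≤ 1)
    (hr : 0 < r) (hC : 0 ≤ C)
    (h : ∀ a, ‖A.τ a f - f‖ ≤ C * (‖a‖ + ‖a‖ ^ β)) :
    ‖A.D v r f‖ ≤ C * (∫ z, (1 + ‖z‖) * |Wt v z|) * (1 + (√r)⁻¹ * √r ^ β) := by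
  have hsr : 0 < √r := Real.sqrt_pos.2 hr
  have e1 : A.D v r f = (√r)⁻¹ • ∫ z, Wt v z • (A.τ (√r • z) f - f) := by
    rw [D_apply]
    congr 1
    simp_rw [smul_sub]
    rw [integral_sub (A.integrableP (integrable_Wt v) _ _) ((integrable_Wt v).smul_const f),
      integral_smul_const, integral_Wt, zero_smul, sub_zero]
  rw [e1, norm_smul, Real.norm_of_nonneg (by positivity)]
  have e2 : ‖∫ z, Wt v z • (A.τ (√r • z) f - f)‖ ≤
      ∫ z, (C * (√r + √r ^ β)) * ((1 + ‖z‖) * |Wt v z|) := by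
    refine norm_integral_le_of_norm_le ((integrable_Wt_poly v).const_mul _)
      (Eventually.of_forall fun z => ?_)
    rw [norm_smul, Real.norm_eq_abs]
    have h1 := h (√r • z)
    rw [norm_smul, Real.norm_of_nonneg hsr.le, Real.mul_rpow hsr.le (norm_nonneg z)] at h1
    have h2 : ‖z‖ ^ β ≤ 1 + ‖z‖ := by
      calc ‖z‖ ^ β ≤ (1 + ‖z‖) ^ β := Real.rpow_le_rpow (norm_nonneg z) (by linarith) hβ.le
        _ ≤ (1 + ‖z‖) ^ (1:ℝ) :=
          Real.rpow_le_rpow_of_exponent_le (by linarith [norm_nonneg z]) hβ1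
        _ = _ := Real.rpow_one _
    have h3 : ‖A.τ (√r • z) f - f‖ ≤ C * (√r * (1 + ‖z‖) + √r ^ β * (1 + ‖z‖)) := by
      refine h1.trans ?_
      gcongr
      linarith
    calc |Wt v z| * ‖A.τ (√r • z) f - f‖
        ≤ |Wt v z| * (C * (√r * (1 + ‖z‖) + √r ^ β * (1 + ‖z‖))) := by gcongr
      _ = _ := by ring
  rw [integral_const_mul] at e2
  calc (√r)⁻¹ * ‖∫ z, Wt v z • (A.τ (√r • z) f - f)‖
      ≤ (√r)⁻¹ * (C * (√r + √r ^ β) * ∫ z, (1 + ‖z‖) * |Wt v z|) := by gcongr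
    _ = _ := by field_simp

/-- Time derivative of the heat semigroup on smooth elements. -/
lemma hasDerivAt_S {f : X} {g k : Fin N → X}
    (h : ∀ i, A.HasD (EuclideanSpace.single i (1:ℝ)) f (g i))
    (h' : ∀ i, A.HasD (EuclideanSpace.single i (1:ℝ)) (g i) (k i)) (r : ℝ) (hr : 0 < r) :
    HasDerivAt (fun r => A.S r f) (A.S r (∑ i, k i)) r := by
  set M := ∑ i, ‖g i‖ with hM
  have hG : ∀ z : EE N, ‖∑ i, z i • g i‖ ≤ M * ‖z‖ := by
    intro z
    refine (norm_sum_le _ _).trans ?_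
    rw [hM, Finset.sum_mul]
    refine Finset.sum_le_sum fun i _ => ?_
    rw [norm_smul, mul_comm]
    gcongr
    exact PiLp.norm_apply_le z i
  simp_rw [S_apply]
  have key := (hasDerivAt_integral_of_dominated_loc_of_deriv_le (𝕜 := ℝ) (μ := volume)
    (F := fun (s : ℝ) (z : EE N) => GK N z • A.τ (√s • z) f)
    (F' := fun (s : ℝ) (z : EE N) => GK N z • ((1 / (2 * √s)) • A.τ (√s • z) (∑ i, z i • g i)))
    (x₀ := r) (s := Ioi (r/4))
    (bound := fun z => ((1 / √r) * M) * ((1 + ‖z‖) ^ 2 * GK N z))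
    (Ioi_mem_nhds (by linarith)) ?_ ?_ ?_ ?_ ?_ ?_).2
  · refine key.congr_deriv ?_
    have e1 : ∀ i, A.S r (k i) = A.D (EuclideanSpace.single i (1:ℝ)) r (g i) :=
      fun i => (A.D_eq_S _ r hr (h' i)).symm
    rw [← S_apply, map_sum]
    simp_rw [e1, D_apply, ← integral_smul]
    rw [← integral_finsetSum]
    · refine integral_congr_ae (Eventually.of_forall fun z => ?_)
      simp only [map_sum, Finset.smul_sum]
      refine Finset.sum_congr rfl fun i _ => ?_
      rw [map_smul]
      simp only [smul_smul, Wt, EuclideanSpace.inner_single_right]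
      congr 1
      simp
      ring
    · intro i _
      exact (A.integrableP (integrable_Wt _) _ _).smul _
  · exact Eventually.of_forall fun s => (A.integrableP (integrable_GK N) _ _).aestronglyMeasurable
  · exact A.integrableP (integrable_GK N) _ _
  · refine Continuous.aestronglyMeasurable ?_
    have h1 := A.cont_comp (a := fun z : EE N => √r • z) (f := fun z => ∑ i, z i • g i)
      (by fun_prop) (by fun_prop)
    have h2 := GK_cont N
    fun_prop
  · refine Eventually.of_forall fun z s hs => ?_
    have hs' : r / 4 < s := hs
    have e1 : √r / 2 ≤ √s := by
      rw [show √r / 2 = √(r/4) by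
        rw [show r / 4 = r / 2^2 by norm_num, Real.sqrt_div hr.le, Real.sqrt_sq (by norm_num)]]
      exact Real.sqrt_le_sqrt hs'.le
    have hsr : 0 < √r := Real.sqrt_pos.2 hr
    have hp := GK_pos N z
    have hss : 0 < √s := by linarith
    rw [norm_smul, norm_smul, Real.norm_of_nonneg hp.le, Real.norm_of_nonneg (by positivity)]
    have e2 : 1 / (2 * √s) ≤ 1 / √r := by
      apply one_div_le_one_div_of_le hsr; linarith
    have hM0 : 0 ≤ M := Finset.sum_nonneg fun i _ => norm_nonneg _
    have e3 : ‖A.τ (√s • z) (∑ i, z i • g i)‖ ≤ M * (1 + ‖z‖)^2 := by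
      refine (A.norm_le _ _).trans ((hG z).trans ?_)
      gcongr
      nlinarith [norm_nonneg z]
    calc _ ≤ GK N z * ((1 / √r) * (M * (1 + ‖z‖)^2)) := by gcongr
      _ = _ := by ring
  · exact (integrable_GK_poly N).const_mul _
  · refine Eventually.of_forall fun z s hs => ?_
    have hs' : 0 < s := lt_trans (by linarith) (show r/4 < s from hs)
    have := ((HasD.all_dir h z).at (√s)).scomp s (Real.hasDerivAt_sqrt hs'.ne')
    exact this.const_smul _

lemma hasDerivWithinAt_S {f : X} {g k : Fin N → X}
    (h : ∀ i, A.HasD (EuclideanSpace.single i (1:ℝ)) f (g i))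
    (h' : ∀ i, A.HasD (EuclideanSpace.single i (1:ℝ)) (g i) (k i)) :
    HasDerivWithinAt (fun r => A.S r f) (∑ i, k i) (Ici 0) 0 := by
  refine hasDerivWithinAt_Ici_of_tendsto_deriv (s := Ioi 0) ?_ ?_ self_mem_nhdsWithin ?_
  · exact fun r hr => (A.hasDerivAt_S h h' r hr).differentiableAt.differentiableWithinAt
  · exact (A.S_cont_comp continuous_id continuous_const).continuousAt.continuousWithinAt
  · have hc : Continuous fun r => A.S r (∑ i, k i) := A.S_cont_comp continuous_id continuous_const
    have := hc.tendsto 0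
    rw [A.S_zero 0 le_rfl] at this
    refine (this.mono_left nhdsWithin_le_nhds).congr' ?_
    filter_upwards [self_mem_nhdsWithin] with r hr
    exact (A.hasDerivAt_S h h' r hr).deriv.symm

end TG

set_option linter.unusedSectionVars false
section Volterra

variable {X : Type*} [NormedAddCommGroup X] [NormedSpace ℝ X]

lemma volterra_int (Q : ℝ → ℝ → X) (φ : ℝ → ℝ)
    (hQ : ∀ r s, 0 < r → ContinuousAt (fun p : ℝ × ℝ => Q p.1 p.2) (r, s))
    (hb : ∀ r s, 0 < r → ‖Q r s‖ ≤ φ r) (hφ : ∀ R, IntervalIntegrable φ volume 0 R)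
    (a t : ℝ) (hat : a ≤ t) : IntervalIntegrable (fun s => Q (t - s) s) volume a t := by
  have h1 : IntervalIntegrable (fun s => φ (t - s)) volume a t := by
    have := ((hφ (t - a)).comp_sub_left t).symm
    simpa using this
  rw [intervalIntegrable_iff_integrableOn_Ioo_of_le hat] at *
  refine Integrable.mono' h1 ?_ ?_
  · refine ContinuousOn.aestronglyMeasurable (fun s hs => ?_) measurableSet_Ioo
    have hc : ContinuousAt (fun s : ℝ => (t - s, s)) s := by fun_prop
    exact (ContinuousAt.comp (x := s) (f := fun s : ℝ => (t - s, s)) (g := fun p : ℝ × ℝ => Q p.1 p.2)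
      (hQ (t - s) s (by linarith [hs.2]))
      hc).continuousWithinAt
  · exact (ae_restrict_iff' measurableSet_Ioo).2
      (Eventually.of_forall fun s hs => hb _ _ (by linarith [hs.2]))

lemma volterra_cont (Q : ℝ → ℝ → X) (φ : ℝ → ℝ)
    (hQ : ∀ r s, 0 < r → ContinuousAt (fun p : ℝ × ℝ => Q p.1 p.2) (r, s))
    (hb : ∀ r s, 0 < r → ‖Q r s‖ ≤ φ r) (hφ : ∀ R, IntervalIntegrable φ volume 0 R)
    (a t₀ : ℝ) (hat : a < t₀) :
    ContinuousAt (fun t => ∫ s in a..t, Q (t - s) s) t₀ := by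
  have hQc : ∀ t r, 0 < r → ContinuousAt (fun r => Q r (t - r)) r := by
    intro t r hr
    have hc : ContinuousAt (fun r : ℝ => (r, t - r)) r := by fun_prop
    exact ContinuousAt.comp (x := r) (f := fun r : ℝ => (r, t - r)) (g := fun p : ℝ × ℝ => Q p.1 p.2)
      (hQ r (t - r) hr) hc
  have h1 : ∀ t, a < t → ∫ s in a..t, Q (t - s) s =
      ∫ r, (Ioc 0 (t - a)).indicator (fun r => Q r (t - r)) r := by
    intro t ht
    have := intervalIntegral.integral_comp_sub_left (a := a) (b := t) (fun r => Q r (t - r)) t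
    simp only [sub_sub_cancel, sub_self] at this
    rw [this, intervalIntegral.integral_of_le (by linarith), integral_indicator measurableSet_Ioc]
  have h2 : (fun t => ∫ s in a..t, Q (t - s) s) =ᶠ[𝓝 t₀]
      fun t => ∫ r, (Ioc 0 (t - a)).indicator (fun r => Q r (t - r)) r := by
    filter_upwards [Ioi_mem_nhds hat] with t ht using h1 t ht
  refine ContinuousAt.congr ?_ h2.symm
  refine continuousAt_of_dominated (bound := (Ioc 0 (t₀ + 1 - a)).indicator φ) ?_ ?_ ?_ ?_
  · refine Eventually.of_forall fun t => ?_
    rw [aestronglyMeasurable_indicator_iff measurableSet_Ioc]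
    exact ContinuousOn.aestronglyMeasurable
      (fun r hr => (hQc t r hr.1).continuousWithinAt) measurableSet_Ioc
  · filter_upwards [Iio_mem_nhds (show t₀ < t₀ + 1 by linarith)] with t ht
    refine Eventually.of_forall fun r => ?_
    have ht' : t < t₀ + 1 := ht
    by_cases hr : r ∈ Ioc 0 (t - a)
    · have hr2 : r ∈ Ioc 0 (t₀ + 1 - a) := ⟨hr.1, by linarith [hr.2]⟩
      rw [indicator_of_mem hr, indicator_of_mem hr2]
      exact hb _ _ hr.1
    · rw [indicator_of_notMem hr, norm_zero]
      by_cases hr2 : r ∈ Ioc 0 (t₀ + 1 - a)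
      · rw [indicator_of_mem hr2]
        exact (norm_nonneg _).trans (hb r 0 hr2.1)
      · rw [indicator_of_notMem hr2]
  · rw [integrable_indicator_iff measurableSet_Ioc]
    exact (intervalIntegrable_iff_integrableOn_Ioc_of_le (by linarith)).1 (hφ _)
  · have : ∀ᵐ r : ℝ, r ≠ t₀ - a := by
      simp [ae_iff]
    filter_upwards [this] with r hr
    by_cases h0 : 0 < r
    · rcases lt_or_gt_of_ne hr with h | h
      · have hev : ∀ᶠ t in 𝓝 t₀, r < t - a := by
          filter_upwards [Ioi_mem_nhds (show r + a < t₀ by linarith)] with t ht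
          have : r + a < t := ht
          linarith
        have hc : ContinuousAt (fun t => Q r (t - r)) t₀ := by
          have hc : ContinuousAt (fun t : ℝ => (r, t - r)) t₀ := by fun_prop
          exact ContinuousAt.comp (x := t₀) (f := fun t : ℝ => (r, t - r))
            (g := fun p : ℝ × ℝ => Q p.1 p.2) (hQ r (t₀ - r) h0) hc
        refine hc.congr ?_
        filter_upwards [hev] with t ht
        rw [indicator_of_mem (show r ∈ Ioc 0 (t - a) from ⟨h0, ht.le⟩)]
      · have hc : ContinuousAt (fun _ : ℝ => (0 : X)) t₀ := continuousAt_const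
        refine hc.congr ?_
        filter_upwards [Iio_mem_nhds (show t₀ < r + a by linarith)] with t ht
        have ht' : t < r + a := ht
        rw [indicator_of_notMem]
        rintro ⟨-, h3⟩
        linarith
    · have hc : ContinuousAt (fun _ : ℝ => (0 : X)) t₀ := continuousAt_const
      refine hc.congr (Eventually.of_forall fun t => ?_)
      exact (indicator_of_notMem (fun h => h0 h.1) _).symm

lemma phi_one_int (C : ℝ) (R : ℝ) : IntervalIntegrable (fun r => (√r)⁻¹ * C) volume 0 R := by
  have h : IntervalIntegrable (fun r : ℝ => r ^ (-(1/2) : ℝ) * C) volume 0 R :=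
    (intervalIntegral.intervalIntegrable_rpow' (by norm_num)).mul_const C
  by_cases hR : 0 ≤ R
  · refine h.congr (fun r hr => ?_)
    rw [uIoc_of_le hR] at hr
    rw [Real.sqrt_eq_rpow, Real.rpow_neg hr.1.le]
  · push Not at hR
    have h0 : IntervalIntegrable (fun _ : ℝ => (0:ℝ)) volume 0 R := intervalIntegrable_const
    refine h0.congr (fun r hr => ?_)
    rw [uIoc_of_ge hR.le] at hr
    simp [Real.sqrt_eq_zero_of_nonpos hr.2]

lemma phi_two_int (C β : ℝ) (hβ : 0 < β) (R : ℝ) :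
    IntervalIntegrable (fun r => (√(r/2))⁻¹ * (1 + (√(r/2))⁻¹ * √(r/2) ^ β) * C) volume 0 R := by
  have key : IntervalIntegrable (fun r => (√r)⁻¹ * (1 + (√r)⁻¹ * √r ^ β) * C) volume (0/2) (R/2) := by
    rw [zero_div]
    have h : IntervalIntegrable
      (fun r : ℝ => (r ^ (-(1/2) : ℝ) + r ^ (-1 + β/2 : ℝ)) * C) volume 0 (R/2) :=
      ((intervalIntegral.intervalIntegrable_rpow' (by norm_num)).add
        (intervalIntegral.intervalIntegrable_rpow' (by linarith))).mul_const C
    by_cases hR : 0 ≤ R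
    · refine h.congr (fun r hr => ?_)
      rw [uIoc_of_le (by positivity)] at hr
      have hr0 : 0 < r := hr.1
      congr 1
      rw [Real.sqrt_eq_rpow, ← Real.rpow_neg hr0.le, ← Real.rpow_mul hr0.le, mul_add, mul_one,
        ← mul_assoc, ← Real.rpow_add hr0, ← Real.rpow_add hr0]
      congr 2; ring
    · push Not at hR
      have h0 : IntervalIntegrable (fun _ : ℝ => (0:ℝ)) volume 0 (R/2) := intervalIntegrable_const
      refine h0.congr (fun r hr => ?_)
      rw [uIoc_of_ge (by linarith)] at hr
      simp [Real.sqrt_eq_zero_of_nonpos hr.2]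
  have := key.comp_mul_right (c := (1/2:ℝ))
  simpa [div_eq_mul_inv] using this

end Volterra

namespace TG

variable {N : ℕ} {X : Type*} [NormedAddCommGroup X] [NormedSpace ℝ X] (A : TG N X)
variable [CompleteSpace X]

lemma hasD_integral (v : EE N) {a t : ℝ} (hat : a ≤ t) {Q Q' : ℝ → X}
    (hQ : IntervalIntegrable Q volume a t) (hQ' : IntervalIntegrable Q' volume a t)
    (h : ∀ s ∈ Ioo a t, A.HasD v (Q s) (Q' s)) :
    A.HasD v (∫ s in a..t, Q s) (∫ s in a..t, Q' s) := by
  have hQi := (intervalIntegrable_iff_integrableOn_Ioo_of_le hat).1 hQ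
  have hQi' := (intervalIntegrable_iff_integrableOn_Ioo_of_le hat).1 hQ'
  rw [intervalIntegral.integral_of_le hat, intervalIntegral.integral_of_le hat,
    integral_Ioc_eq_integral_Ioo, integral_Ioc_eq_integral_Ioo]
  unfold HasD
  have e : ∀ s : ℝ, A.τ (s • v) (∫ s in Ioo a t, Q s) = ∫ x in Ioo a t, A.τ (s • v) (Q x) :=
    fun s => (ContinuousLinearMap.integral_comp_comm _ hQi).symm
  simp_rw [e]
  have key := (hasDerivAt_integral_of_dominated_loc_of_deriv_le (𝕜 := ℝ)
    (μ := volume.restrict (Ioo a t))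
    (F := fun (s : ℝ) (x : ℝ) => A.τ (s • v) (Q x))
    (F' := fun (s : ℝ) (x : ℝ) => A.τ (s • v) (Q' x))
    (x₀ := (0:ℝ)) (s := univ) (bound := fun x => ‖Q' x‖) univ_mem ?_ ?_ ?_ ?_ ?_ ?_).2
  · simpa [A.zero] using key
  · exact Eventually.of_forall fun s =>
      ((A.τ (s • v)).continuous.comp_aestronglyMeasurable hQi.aestronglyMeasurable)
  · simp only [zero_smul, A.zero]; exact hQi
  · simp only [zero_smul, A.zero]; exact hQi'.aestronglyMeasurable
  · exact Eventually.of_forall fun x s _ => A.norm_le _ _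
  · exact hQi'.norm
  · refine (ae_restrict_iff' measurableSet_Ioo).2 (Eventually.of_forall fun x hx s _ => ?_)
    exact (h x hx).at s

/-- Mild solutions. -/
def Mild (a b : ℝ) (u G : ℝ → X) : Prop :=
  ∀ t ∈ Icc a b, u t = A.S (t - a) (u a) + ∫ s in a..t, A.S (t - s) (G s)

variable {A}

lemma S_cont_duh {G : ℝ → X} (hG : Continuous G) (t : ℝ) :
    Continuous fun s => A.S (t - s) (G s) := A.S_cont_comp (by fun_prop) hG

lemma Mild.restart {a b c : ℝ} {u G : ℝ → X} (h : A.Mild a b u G) (hG : Continuous G)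
    (hac : a ≤ c) (hcb : c ≤ b) : A.Mild c b u G := by
  intro t ht
  have h1 := h t ⟨hac.trans ht.1, ht.2⟩
  have h2 := h c ⟨hac, hcb⟩
  have hIntg : ∀ t x y, IntervalIntegrable (fun s => A.S (t - s) (G s)) volume x y :=
    fun t x y => (S_cont_duh hG t).intervalIntegrable _ _
  rw [h1, h2, map_add, A.S_add _ _ (by linarith [ht.1]) (by linarith),
    ← intervalIntegral.integral_add_adjacent_intervals (hIntg t a c) (hIntg t c t),
    ← ContinuousLinearMap.intervalIntegral_comp_comm _ (hIntg c a c)]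
  have e : ∫ s in a..c, A.S (t - c) (A.S (c - s) (G s)) = ∫ s in a..c, A.S (t - s) (G s) := by
    refine intervalIntegral.integral_congr fun s hs => ?_
    rw [uIcc_of_le hac] at hs
    rw [A.S_add _ _ (by linarith [ht.1]) (by linarith [hs.2])]
    congr 2; ring
  rw [e, show t - c + (c - a) = t - a by ring]
  abel

lemma Mild.congr {a b : ℝ} {u G u' G' : ℝ → X} (h : A.Mild a b u G) (hab : a ≤ b)
    (hu : ∀ t ∈ Icc a b, u' t = u t) (hG : ∀ t ∈ Icc a b, G' t = G t) : A.Mild a b u' G' := by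
  intro t ht
  rw [hu t ht, hu a ⟨le_rfl, hab⟩, h t ht]
  congr 1
  refine intervalIntegral.integral_congr fun s hs => ?_
  rw [uIcc_of_le ht.1] at hs
  rw [hG s ⟨hs.1, hs.2.trans ht.2⟩]

/-- First derivative of a mild solution. -/
lemma Mild.hasD {a b : ℝ} {u G : ℝ → X} (h : A.Mild a b u G) (hG : Continuous G)
    {M : ℝ} (hM : ∀ s, ‖G s‖ ≤ M) (v : EE N) :
    (∀ t ∈ Ioc a b, A.HasD v (u t) (A.D v (t - a) (u a) + ∫ s in a..t, A.D v (t - s) (G s))) ∧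
    (∀ t, a < t → ContinuousAt
      (fun t => A.D v (t - a) (u a) + ∫ s in a..t, A.D v (t - s) (G s)) t) := by
  have hQ : ∀ r s, 0 < r → ContinuousAt (fun p : ℝ × ℝ => A.D v p.1 (G p.2)) (r, s) := by
    intro r s hr
    exact A.D_cont_comp v (by fun_prop) hr (hG.continuousAt.comp continuousAt_snd)
  have hb : ∀ r s, 0 < r → ‖A.D v r (G s)‖ ≤ (√r)⁻¹ * ((∫ z, |Wt v z|) * M) := by
    intro r s hr
    refine (A.norm_D_le v r (G s)).trans ?_
    rw [mul_assoc]
    have : 0 ≤ ∫ z, |Wt v z| := integral_nonneg fun z => abs_nonneg _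
    gcongr
    exact hM s
  refine ⟨fun t ht => ?_, fun t ht => ?_⟩
  · rw [h t ⟨ht.1.le, ht.2⟩]
    refine (A.hasD_S v _ (by linarith [ht.1]) _).add ?_
    refine A.hasD_integral v ht.1.le ((S_cont_duh hG t).intervalIntegrable _ _) ?_ ?_
    · exact volterra_int (fun r s => A.D v r (G s)) _ hQ hb (phi_one_int _) a t ht.1.le
    · exact fun s hs => A.hasD_S v _ (by linarith [hs.2]) _
  · refine ContinuousAt.add ?_ ?_
    · exact A.D_cont_comp v (by fun_prop) (by linarith) continuousAt_const
    · exact volterra_cont (fun r s => A.D v r (G s)) _ hQ hb (phi_one_int _) a t ht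

/-- Second derivative of a mild solution with Hoelder forcing. -/
lemma Mild.hasDD {a b : ℝ} {u G : ℝ → X} (hG : Continuous G)
    {M C β : ℝ} (hM : ∀ s, ‖G s‖ ≤ M) (hC : 0 ≤ C) (hβ : 0 < β) (hβ1 : β ≤ 1)
    (hH : ∀ s x, ‖A.τ x (G s) - G s‖ ≤ C * (‖x‖ + ‖x‖ ^ β)) (v w : EE N) :
    (∀ t ∈ Ioc a b, A.HasD w (A.D v (t - a) (u a) + ∫ s in a..t, A.D v (t - s) (G s))
      (A.D w ((t - a)/2) (A.D v ((t-a)/2) (u a)) +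
        ∫ s in a..t, A.D w ((t - s)/2) (A.D v ((t - s)/2) (G s)))) ∧
    (∀ t, a < t → ContinuousAt
      (fun t => A.D w ((t - a)/2) (A.D v ((t-a)/2) (u a)) +
        ∫ s in a..t, A.D w ((t - s)/2) (A.D v ((t - s)/2) (G s))) t) := by
  have hQ1 : ∀ r s, 0 < r → ContinuousAt (fun p : ℝ × ℝ => A.D v p.1 (G p.2)) (r, s) := by
    intro r s hr
    exact A.D_cont_comp v (by fun_prop) hr (hG.continuousAt.comp continuousAt_snd)
  have hb1 : ∀ r s, 0 < r → ‖A.D v r (G s)‖ ≤ (√r)⁻¹ * ((∫ z, |Wt v z|) * M) := by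
    intro r s hr
    refine (A.norm_D_le v r (G s)).trans ?_
    rw [mul_assoc]
    have : 0 ≤ ∫ z, |Wt v z| := integral_nonneg fun z => abs_nonneg _
    gcongr
    exact hM s
  have hQ : ∀ r s, 0 < r →
      ContinuousAt (fun p : ℝ × ℝ => A.D w (p.1/2) (A.D v (p.1/2) (G p.2))) (r, s) := by
    intro r s hr
    refine A.D_cont_comp w (by fun_prop) (by simpa using hr) ?_
    exact A.D_cont_comp v (by fun_prop) (by simpa using hr) (hG.continuousAt.comp continuousAt_snd)
  have hb : ∀ r s, 0 < r → ‖A.D w (r/2) (A.D v (r/2) (G s))‖ ≤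
      (√(r/2))⁻¹ * (1 + (√(r/2))⁻¹ * √(r/2) ^ β) *
        ((∫ z, |Wt w z|) * (C * (∫ z, (1 + ‖z‖) * |Wt v z|))) := by
    intro r s hr
    have h1 := A.norm_D_le w (r/2) (A.D v (r/2) (G s))
    have h2 := A.norm_D_le_holder v (r/2) (G s) C β hβ hβ1 (by positivity) hC (hH s)
    have : 0 ≤ ∫ z, |Wt w z| := integral_nonneg fun z => abs_nonneg _
    calc _ ≤ _ := h1
      _ ≤ (√(r/2))⁻¹ * (∫ z, |Wt w z|) *
          (C * (∫ z, (1 + ‖z‖) * |Wt v z|) * (1 + (√(r/2))⁻¹ * √(r/2) ^ β)) := by gcongr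
      _ = _ := by ring
  refine ⟨fun t ht => ?_, fun t ht => ?_⟩
  · refine (A.hasD_D w v _ (by linarith [ht.1]) _).add ?_
    refine A.hasD_integral w ht.1.le ?_ ?_ ?_
    · exact volterra_int (fun r s => A.D v r (G s)) _ hQ1 hb1 (phi_one_int _) a t ht.1.le
    · exact volterra_int (fun r s => A.D w (r/2) (A.D v (r/2) (G s))) _ hQ hb
        (phi_two_int _ β hβ) a t ht.1.le
    · exact fun s hs => A.hasD_D w v _ (by linarith [hs.2]) _
  · refine ContinuousAt.add ?_ ?_
    · refine A.D_cont_comp w (by fun_prop) (by linarith) ?_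
      exact A.D_cont_comp v (by fun_prop) (by linarith) continuousAt_const
    · exact volterra_cont (fun r s => A.D w (r/2) (A.D v (r/2) (G s))) _ hQ hb
        (phi_two_int _ β hβ) a t ht

/-- The derivative of a mild solution is a mild solution. -/
lemma Mild.deriv_mild {a b : ℝ} {u G V H : ℝ → X} (h : A.Mild a b u G) (hG : Continuous G)
    (hH : Continuous H) (v : EE N) (hab : a ≤ b) (hV : ∀ t ∈ Icc a b, A.HasD v (u t) (V t))
    (hGH : ∀ t ∈ Icc a b, A.HasD v (G t) (H t)) : A.Mild a b V H := by
  intro t ht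
  refine (hV t ht).unique ?_
  rw [h t ht]
  refine ((hV a ⟨le_rfl, hab⟩).clm (A.S (t - a)) fun _ _ => A.S_comm _ _ _).add ?_
  refine A.hasD_integral v ht.1 ((S_cont_duh hG t).intervalIntegrable _ _)
    ((S_cont_duh hH t).intervalIntegrable _ _) fun s hs => ?_
  exact (hGH s ⟨hs.1.le, hs.2.le.trans ht.2⟩).clm (A.S (t - s)) fun _ _ => A.S_comm _ _ _

lemma duh_right_deriv {G : ℝ → X} (hG : Continuous G) (t : ℝ) :
    HasDerivWithinAt (fun t' => ∫ s in t..t', A.S (t' - s) (G s)) (G t) (Ici t) t := by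
  rw [hasDerivWithinAt_iff_isLittleO, Asymptotics.isLittleO_iff]
  intro ε hε
  have hc : Continuous (fun p : ℝ × ℝ => A.S (p.1 - p.2) (G p.2)) :=
    A.S_cont_comp (by fun_prop) (by fun_prop)
  have h0 := hc.tendsto (t, t)
  simp only [sub_self, A.S_zero 0 le_rfl] at h0
  rw [Metric.tendsto_nhds] at h0
  obtain ⟨δ, hδ, h1⟩ := Metric.eventually_nhds_iff.1 (h0 ε hε)
  have hev : ∀ᶠ x in 𝓝[Ici t] t, x ∈ Ici t ∩ Metric.ball t δ :=
    inter_mem self_mem_nhdsWithin (nhdsWithin_le_nhds (Metric.ball_mem_nhds _ hδ))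
  filter_upwards [hev] with x hx
  have hx1 : t ≤ x := hx.1
  have hx2 : |x - t| < δ := by simpa [Real.dist_eq] using hx.2
  rw [intervalIntegral.integral_same, sub_zero]
  have e : (x - t) • G t = ∫ s in t..x, G t := by simp
  rw [e, ← intervalIntegral.integral_sub ((S_cont_duh hG x).intervalIntegrable _ _)
    intervalIntegrable_const, Real.norm_eq_abs]
  refine intervalIntegral.norm_integral_le_of_norm_le_const fun s hs => ?_
  rw [uIoc_of_le hx1] at hs
  have := @h1 (x, s) (by
    rw [Prod.dist_eq]
    refine max_lt (by simpa [Real.dist_eq] using hx2) ?_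
    rw [Real.dist_eq]
    rw [abs_of_nonneg (by linarith [hs.1])]
    rw [abs_of_nonneg (by linarith)] at hx2
    simp only; linarith [hs.2])
  rw [dist_eq_norm] at this
  exact this.le

/-- Time derivative of a mild solution. -/
lemma Mild.hasDerivAt {a b : ℝ} {u G : ℝ → X} (h : A.Mild a b u G) (hG : Continuous G)
    (hu : ContinuousOn u (Icc a b)) {V W : Fin N → ℝ → X}
    (hV : ∀ i, ∀ t ∈ Ioo a b, A.HasD (EuclideanSpace.single i (1:ℝ)) (u t) (V i t))
    (hW : ∀ i, ∀ t ∈ Ioo a b, A.HasD (EuclideanSpace.single i (1:ℝ)) (V i t) (W i t))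
    (hWc : ∀ i, ContinuousOn (W i) (Ioo a b)) (t₀ : ℝ) (ht₀ : t₀ ∈ Ioo a b) :
    HasDerivAt u (∑ i, W i t₀ + G t₀) t₀ := by
  set H : ℝ → X := fun t => ∑ i, W i t + G t with hH
  have hHc : ContinuousOn H (Ioo a b) :=
    (continuousOn_finsetSum _ fun i _ => hWc i).add hG.continuousOn
  have hright : ∀ t ∈ Ioo a b, HasDerivWithinAt u (H t) (Ici t) t := by
    intro t ht
    have h1 := h.restart hG ht.1.le ht.2.le
    have h2 : HasDerivWithinAt (fun t' => A.S (t' - t) (u t)) (∑ i, W i t) (Ici t) t := by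
      have h3 := A.hasDerivWithinAt_S (f := u t) (fun i => hV i t ht) (fun i => hW i t ht)
      have h4 : HasDerivWithinAt (fun t' : ℝ => t' - t) 1 (Ici t) t :=
        ((hasDerivAt_id t).sub_const t).hasDerivWithinAt
      have h5 : HasDerivWithinAt (fun r => A.S r (u t)) (∑ i, W i t) (Ici 0) (t - t) := by
        rw [sub_self]; exact h3
      have := HasDerivWithinAt.scomp (h := fun t' : ℝ => t' - t) (t' := Ici 0) t h5 h4 (fun x hx => by
        have : t ≤ x := hx
        simp only [mem_Ici]; linarith)
      simpa [Function.comp_def] using this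
    refine (h2.add (duh_right_deriv (A := A) hG t)).congr_of_eventuallyEq ?_ ?_
    · have : ∀ᶠ x in 𝓝[Ici t] t, x ∈ Ici t ∩ Iio b :=
        inter_mem self_mem_nhdsWithin (nhdsWithin_le_nhds (Iio_mem_nhds ht.2))
      filter_upwards [this] with x hx
      exact h1 x ⟨hx.1, (show x < b from hx.2).le⟩
    · exact h1 t ⟨le_rfl, ht.2.le⟩
  obtain ⟨ha, hb⟩ := ht₀
  set c := (a + t₀)/2 with hc
  set d := (t₀ + b)/2 with hd
  have hΦ : ∀ t ∈ Ioo a b, HasDerivAt (fun t => ∫ s in c..t, H s) (H t) t := by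
    intro t ht
    refine intervalIntegral.integral_hasDerivAt_right ?_ ?_ ?_
    · refine (hHc.mono ?_).intervalIntegrable
      have hcm : c ∈ Ioo a b := ⟨by linarith, by linarith⟩
      exact (convex_Ioo a b).ordConnected.uIcc_subset hcm ht
    · exact hHc.stronglyMeasurableAtFilter isOpen_Ioo t ht
    · exact hHc.continuousAt (isOpen_Ioo.mem_nhds ht)
  have hsub : Icc c d ⊆ Ioo a b := fun x hx => ⟨by linarith [hx.1], by linarith [hx.2]⟩
  have hY := constant_of_has_deriv_right_zero (a := c) (b := d)
    (f := fun t => u t - ∫ s in c..t, H s)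
    ((hu.mono (hsub.trans Ioo_subset_Icc_self)).sub fun t ht =>
      (hΦ t (hsub ht)).continuousAt.continuousWithinAt)
    (fun t ht => by
      have ht' := hsub (Ico_subset_Icc_self ht)
      have h9 := (hright t ht').sub (hΦ t ht').hasDerivWithinAt
      rw [sub_self] at h9
      exact h9.mono Subset.rfl)
  have hfin := (hΦ t₀ ⟨ha, hb⟩).add_const (u c)
  refine hfin.congr_of_eventuallyEq ?_
  filter_upwards [Icc_mem_nhds (show c < t₀ by linarith) (show t₀ < d by linarith)] with t ht
  have := hY t ht
  simp only [intervalIntegral.integral_same, sub_zero] at this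
  rw [← this]; abel

end TG

section Concrete

/-- Bounded uniformly continuous functions. -/
def CbuS (N : ℕ) : Submodule ℝ (BoundedContinuousFunction (EE N) ℝ) where
  carrier := {f | UniformContinuous f}
  add_mem' := fun {f g} hf hg => by
    have : UniformContinuous (fun x => f x + g x) := UniformContinuous.add hf hg
    exact this
  zero_mem' := by
    have : UniformContinuous (fun _ : EE N => (0:ℝ)) := uniformContinuous_const
    exact this
  smul_mem' := fun c f hf => by
    have : UniformContinuous (fun x => c • f x) := UniformContinuous.const_smul hf c
    exact this

variable {N : ℕ}

lemma CbuS_closed : IsClosed (CbuS N : Set (BoundedContinuousFunction (EE N) ℝ)) := by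
  refine isClosed_of_closure_subset fun f hf => ?_
  have : UniformContinuous f := by
    rw [Metric.uniformContinuous_iff]
    intro ε hε
    obtain ⟨g, hg, hfg⟩ := Metric.mem_closure_iff.1 hf (ε/3) (by positivity)
    have hg' : UniformContinuous g := hg
    obtain ⟨δ, hδ, h⟩ := Metric.uniformContinuous_iff.1 hg' (ε/3) (by positivity)
    refine ⟨δ, hδ, fun {a b} hab => ?_⟩
    have h1 := dist_coe_le_dist (f := f) (g := g) a
    have h2 := dist_coe_le_dist (f := f) (g := g) b
    have h3 := h hab
    have h4 := dist_triangle4 (f a) (g a) (g b) (f b)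
    rw [dist_comm (g b) (f b)] at h4
    linarith
  exact this

/-- The Banach space of bounded uniformly continuous functions. -/
def Cbu (N : ℕ) : Type := ↥(CbuS N)

noncomputable instance : NormedAddCommGroup (Cbu N) := inferInstanceAs (NormedAddCommGroup ↥(CbuS N))
noncomputable instance : NormedSpace ℝ (Cbu N) := inferInstanceAs (NormedSpace ℝ ↥(CbuS N))
instance : CompleteSpace (Cbu N) := CbuS_closed.completeSpace_coe

/-- Build an element. -/
noncomputable def mkC (f : EE N → ℝ) (hf : UniformContinuous f) (hb : ∃ C, ∀ x, ‖f x‖ ≤ C) : Cbu N :=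
  ⟨BoundedContinuousFunction.ofNormedAddCommGroup f hf.continuous hb.choose hb.choose_spec, hf⟩

@[simp] lemma mkC_apply (f : EE N → ℝ) (hf : UniformContinuous f) (hb : ∃ C, ∀ x, ‖f x‖ ≤ C) (x : EE N) :
    (mkC f hf hb).1 x = f x := rfl

lemma Cbu_norm_le {f : Cbu N} {C : ℝ} (hC : 0 ≤ C) (h : ∀ x, |f.1 x| ≤ C) : ‖f‖ ≤ C :=
  (BoundedContinuousFunction.norm_le hC).2 h

lemma Cbu_abs_le (f : Cbu N) (x : EE N) : |f.1 x| ≤ ‖f‖ := f.1.norm_coe_le_norm x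

lemma Cbu_uc (f : Cbu N) : UniformContinuous f.1 := f.2

lemma Cbu_ext {f g : Cbu N} (h : ∀ x, f.1 x = g.1 x) : f = g :=
  Subtype.ext (BoundedContinuousFunction.ext h)

/-- Evaluation. -/
noncomputable def evC (x : EE N) : Cbu N →L[ℝ] ℝ :=
  LinearMap.mkContinuous
    { toFun := fun f : Cbu N => f.1 x
      map_add' := fun _ _ => rfl
      map_smul' := fun _ _ => rfl } 1 (fun f => by rw [one_mul]; exact Cbu_abs_le f x)

@[simp] lemma evC_apply (x : EE N) (f : Cbu N) : evC x f = f.1 x := rfl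

lemma uc_shift (a : EE N) : UniformContinuous fun x : EE N => x + a :=
  uniformContinuous_id.add uniformContinuous_const

/-- Translation. -/
noncomputable def trC (a : EE N) : Cbu N →L[ℝ] Cbu N :=
  LinearMap.mkContinuous
    { toFun := fun f => mkC (fun x => f.1 (x + a)) ((Cbu_uc f).comp (uc_shift a))
        ⟨‖f‖, fun x => Cbu_abs_le f _⟩
      map_add' := fun _ _ => Cbu_ext fun _ => rfl
      map_smul' := fun _ _ => Cbu_ext fun _ => rfl } 1 (fun f => by
        rw [one_mul]; exact Cbu_norm_le (norm_nonneg _) fun x => Cbu_abs_le f _)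

@[simp] lemma trC_apply (a : EE N) (f : Cbu N) (x : EE N) : (trC a f).1 x = f.1 (x + a) := rfl

/-- The translation group. -/
noncomputable def TC (N : ℕ) : TG N (Cbu N) where
  τ := trC
  zero := fun f => Cbu_ext fun x => by simp
  add := fun a b f => Cbu_ext fun x => by simp [add_assoc]
  norm_le := fun a f => Cbu_norm_le (norm_nonneg _) fun x => Cbu_abs_le f _
  cont := fun f => by
    rw [Metric.continuous_iff]
    intro b ε hε
    obtain ⟨δ, hδ, h⟩ := Metric.uniformContinuous_iff.1 (Cbu_uc f) (ε/2) (by positivity)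
    refine ⟨δ, hδ, fun a ha => ?_⟩
    rw [dist_eq_norm]
    refine (Cbu_norm_le (by positivity) fun x => ?_).trans_lt (half_lt_self hε)
    have := @h (x + a) (x + b) (by simpa using ha)
    rw [Real.dist_eq] at this
    exact this.le

@[simp] lemma TC_apply (a : EE N) (f : Cbu N) (x : EE N) : ((TC N).τ a f).1 x = f.1 (x + a) := rfl

lemma HasD_pt {v : EE N} {f g : Cbu N} (h : (TC N).HasD v f g) (x : EE N) :
    HasDerivAt (fun s : ℝ => f.1 (x + s • v)) (g.1 x) 0 :=
  (evC x).hasFDerivAt.comp_hasDerivAt (0:ℝ) h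

lemma HasD_of_pt {v : EE N} {f g : Cbu N}
    (h : ∀ x, HasDerivAt (fun s : ℝ => f.1 (x + s • v)) (g.1 x) 0) : (TC N).HasD v f g := by
  have h' : ∀ x s, HasDerivAt (fun s : ℝ => f.1 (x + s • v)) (g.1 (x + s • v)) s := by
    intro x s
    have h2 : HasDerivAt (fun r : ℝ => f.1 ((x + s • v) + r • v)) (g.1 (x + s • v)) (s - s) := by
      rw [sub_self]; exact h _
    have := h2.comp_sub_const s s
    refine this.congr_of_eventuallyEq (Eventually.of_forall fun r => ?_)
    simp only
    congr 1
    rw [add_assoc, ← add_smul]; congr 2; ring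
  unfold TG.HasD
  rw [hasDerivAt_iff_isLittleO, Asymptotics.isLittleO_iff]
  intro ε hε
  have hc : ContinuousAt (fun s : ℝ => (TC N).τ (s • v) g) 0 :=
    ((TC N).cont_comp (by fun_prop) continuous_const).continuousAt
  rw [Metric.continuousAt_iff] at hc
  obtain ⟨δ, hδ, hc⟩ := hc ε hε
  filter_upwards [Metric.ball_mem_nhds (0:ℝ) hδ] with s hs
  refine Cbu_norm_le (by positivity) fun x => ?_
  have key := (convex_ball (0:ℝ) δ).norm_image_sub_le_of_norm_hasDerivWithin_le
    (f := fun s : ℝ => f.1 (x + s • v) - s * g.1 x) (f' := fun s => g.1 (x + s • v) - 1 * g.1 x)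
    (C := ε) (x := 0) (y := s)
    (fun r hr => ((h' x r).sub ((hasDerivAt_id r).mul_const _)).hasDerivWithinAt) (fun r hr => by
      have h1 := hc hr
      rw [zero_smul, (TC N).zero, dist_eq_norm] at h1
      have h2 := Cbu_abs_le ((TC N).τ (r • v) g - g) x
      have h3 : ((TC N).τ (r • v) g - g).1 x = g.1 (x + r • v) - g.1 x := rfl
      rw [h3] at h2
      rw [one_mul, Real.norm_eq_abs]; linarith) (Metric.mem_ball_self hδ) hs
  have e : ((TC N).τ (s • v) f - (TC N).τ ((0:ℝ) • v) f - (s - 0) • g).1 x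
      = f.1 (x + s • v) - s * g.1 x - (f.1 (x + (0:ℝ) • v) - 0 * g.1 x) := by
    have : ((TC N).τ (s • v) f - (TC N).τ ((0:ℝ) • v) f - (s - 0) • g).1 x =
      f.1 (x + s • v) - f.1 (x + (0:ℝ) • v) - (s - 0) * g.1 x := rfl
    rw [this]; ring
  rw [e]
  exact key

/-- Nemytskii operator. -/
noncomputable def nem (φ : ℝ × ℝ → ℝ) (hφ : Continuous φ) (p : Cbu N × Cbu N) : Cbu N :=
  mkC (fun x => φ (p.1.1 x, p.2.1 x))
    (by
      have hK : IsCompact (Metric.closedBall (0 : ℝ × ℝ) ‖p‖) := isCompact_closedBall _ _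
      have h1 := hK.uniformContinuousOn_of_continuous hφ.continuousOn
      have h2 : UniformContinuous (fun x => (p.1.1 x, p.2.1 x)) := (Cbu_uc p.1).prodMk (Cbu_uc p.2)
      refine uniformContinuousOn_univ.1 (h1.comp h2.uniformContinuousOn fun x _ => ?_)
      rw [mem_closedBall_zero_iff, Prod.norm_def]
      exact max_le ((Cbu_abs_le p.1 x).trans (norm_fst_le p)) ((Cbu_abs_le p.2 x).trans (norm_snd_le p)))
    (by
      have hK : IsCompact (Metric.closedBall (0 : ℝ × ℝ) ‖p‖) := isCompact_closedBall _ _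
      obtain ⟨C, hC⟩ := hK.exists_bound_of_continuousOn hφ.continuousOn
      refine ⟨C, fun x => hC _ ?_⟩
      rw [mem_closedBall_zero_iff, Prod.norm_def]
      exact max_le ((Cbu_abs_le p.1 x).trans (norm_fst_le p)) ((Cbu_abs_le p.2 x).trans (norm_snd_le p)))

@[simp] lemma nem_apply (φ : ℝ × ℝ → ℝ) (hφ : Continuous φ) (p : Cbu N × Cbu N) (x : EE N) :
    (nem φ hφ p).1 x = φ (p.1.1 x, p.2.1 x) := rfl

lemma nem_cont (φ : ℝ × ℝ → ℝ) (hφ : Continuous φ) : Continuous (nem (N := N) φ hφ) := by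
  rw [Metric.continuous_iff]
  intro p ε hε
  have hK : IsCompact (Metric.closedBall (0 : ℝ × ℝ) (‖p‖ + 1)) := isCompact_closedBall _ _
  have h1 := hK.uniformContinuousOn_of_continuous hφ.continuousOn
  obtain ⟨δ, hδ, h⟩ := Metric.uniformContinuousOn_iff.1 h1 (ε/2) (by positivity)
  refine ⟨min δ 1, by positivity, fun q hq => ?_⟩
  have hq1 : ‖q - p‖ < δ := by rw [← dist_eq_norm]; exact hq.trans_le (min_le_left _ _)
  have hq2 : ‖q - p‖ < 1 := by rw [← dist_eq_norm]; exact hq.trans_le (min_le_right _ _)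
  have hq3 : ‖q‖ ≤ ‖p‖ + 1 := by
    have := norm_le_norm_add_norm_sub' q p
    linarith
  have hmem : ∀ (p : Cbu N × Cbu N) x, ‖(p.1.1 x, p.2.1 x)‖ ≤ ‖p‖ := by
    intro p x
    rw [Prod.norm_def]
    exact max_le ((Cbu_abs_le p.1 x).trans (norm_fst_le p)) ((Cbu_abs_le p.2 x).trans (norm_snd_le p))
  rw [dist_eq_norm]
  refine (Cbu_norm_le (by positivity) fun x => ?_).trans_lt (half_lt_self hε)
  have := h (q.1.1 x, q.2.1 x) (by rw [mem_closedBall_zero_iff]; exact (hmem q x).trans hq3)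
    (p.1.1 x, p.2.1 x) (by rw [mem_closedBall_zero_iff]; exact (hmem p x).trans (by linarith))
    (by rw [dist_eq_norm]; exact (hmem (q - p) x).trans_lt hq1)
  rw [Real.dist_eq] at this
  exact this.le

lemma gaussK_scale (r : ℝ) (hr : 0 < r) (z : EE N) :
    gaussK N r (√r • z) * √r ^ N = GK N z := by
  rw [GK_eq]
  unfold gaussK
  rw [norm_smul, Real.norm_eq_abs, abs_of_nonneg (Real.sqrt_nonneg r), mul_pow, Real.sq_sqrt hr.le,
    Real.mul_rpow (by positivity) hr.le]
  have h1 : r ^ (-(N:ℝ)/2) * √r ^ N = 1 := by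
    rw [Real.sqrt_eq_rpow, ← Real.rpow_natCast, ← Real.rpow_mul hr.le, ← Real.rpow_add hr]
    rw [show -(N:ℝ)/2 + 1/2 * N = 0 by ring, Real.rpow_zero]
  have h2 : -(r * ‖z‖^2) / (4 * r) = -(1/4) * ‖z‖^2 := by field_simp
  rw [h2]
  calc _ = (4 * π) ^ (-(N:ℝ)/2) * rexp (-(1/4) * ‖z‖^2) * (r ^ (-(N:ℝ)/2) * √r ^ N) := by ring
    _ = _ := by rw [h1, mul_one]

lemma S_pt (r : ℝ) (hr : 0 < r) (f : Cbu N) (x : EE N) :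
    ((TC N).S r f).1 x = ∫ y, gaussK N r (x - y) * f.1 y := by
  have hs : 0 < √r := Real.sqrt_pos.2 hr
  rw [← evC_apply, TG.S_apply, ← ContinuousLinearMap.integral_comp_comm _
    ((TC N).integrableP (integrable_GK N) _ f)]
  rw [← integral_add_left_eq_self (fun y => gaussK N r (x - y) * f.1 y) x]
  have h1 := Measure.integral_comp_smul_of_nonneg (volume : Measure (EE N))
    (fun w => gaussK N r (x - (x + w)) * f.1 (x + w)) √r (hR := hs.le)
  rw [finrank_euclideanSpace_fin, smul_eq_mul] at h1
  have h2 : ∫ w, gaussK N r (x - (x + w)) * f.1 (x + w) =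
      √r ^ N * ∫ z, gaussK N r (x - (x + √r • z)) * f.1 (x + √r • z) := by
    rw [h1, ← mul_assoc, mul_inv_cancel₀ (by positivity), one_mul]
  rw [h2, ← integral_const_mul]
  refine integral_congr_ae (Eventually.of_forall fun z => ?_)
  simp only [map_smul, evC_apply, TC_apply, smul_eq_mul]
  have h3 : gaussK N r (x - (x + √r • z)) = gaussK N r (√r • z) := by
    rw [sub_add_cancel_left]; unfold gaussK; rw [norm_neg]
  rw [h3, ← gaussK_scale r hr z]; ring

end Concrete

section Scalar

lemma hasDerivAt_pw (α : ℝ) (hα : 0 < α) (y : ℝ) :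
    HasDerivAt (fun y : ℝ => |y| ^ α * y) ((α + 1) * |y| ^ α) y := by
  rcases lt_trichotomy y 0 with h | h | h
  · have h1 : HasDerivAt (fun y : ℝ => (-y) ^ α * y) ((α + 1) * |y| ^ α) y := by
      have h2 : HasDerivAt (fun y : ℝ => (-y) ^ α) (-1 * α * (-y) ^ (α - 1)) y :=
        ((hasDerivAt_id y).neg).rpow_const (Or.inl (by simp; exact h.ne))
      refine (h2.mul (hasDerivAt_id y)).congr_deriv ?_
      rw [abs_of_neg h, Real.rpow_sub_one (by linarith)]
      have : y ≠ 0 := h.ne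
      simp only [id]
      field_simp
    refine h1.congr_of_eventuallyEq ?_
    filter_upwards [Iio_mem_nhds h] with z hz
    rw [abs_of_neg hz]
  · subst h
    rw [abs_zero, Real.zero_rpow hα.ne', mul_zero, hasDerivAt_iff_tendsto_slope_zero]
    have hc : Continuous fun t : ℝ => |t| ^ α := continuous_abs.rpow_const fun _ => Or.inr hα.le
    have h1 := hc.tendsto 0
    rw [abs_zero, Real.zero_rpow hα.ne'] at h1
    refine (h1.mono_left nhdsWithin_le_nhds).congr' ?_
    filter_upwards [self_mem_nhdsWithin] with t ht
    have : t ≠ 0 := ht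
    simp only [zero_add, mul_zero, sub_zero, smul_eq_mul]
    field_simp
  · have h1 : HasDerivAt (fun y : ℝ => y ^ α * y) ((α + 1) * |y| ^ α) y := by
      have h2 : HasDerivAt (fun y : ℝ => y ^ α) (1 * α * y ^ (α - 1)) y :=
        (hasDerivAt_id y).rpow_const (Or.inl h.ne')
      refine (h2.mul (hasDerivAt_id y)).congr_deriv ?_
      rw [abs_of_pos h, Real.rpow_sub_one h.ne']
      simp only [id]
      field_simp
    refine h1.congr_of_eventuallyEq ?_
    filter_upwards [Ioi_mem_nhds h] with z hz
    rw [abs_of_pos hz]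

lemma pw_holder (α : ℝ) (hα : 0 < α) (R : ℝ) (hR : 0 ≤ R) : ∃ C, 0 ≤ C ∧ ∀ a b : ℝ, |a| ≤ R → |b| ≤ R →
    |(|a| ^ α - |b| ^ α)| ≤ C * |a - b| ^ (min α 1) := by
  rcases le_total α 1 with h | h
  · refine ⟨1, zero_le_one, fun a b _ _ => ?_⟩
    rw [min_eq_left h, one_mul]
    have key : ∀ a b : ℝ, |a| ^ α ≤ |b| ^ α + |a - b| ^ α := by
      intro a b
      refine le_trans ?_ (Real.rpow_add_le_add_rpow (abs_nonneg b) (abs_nonneg (a - b)) hα.le h)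
      refine Real.rpow_le_rpow (abs_nonneg _) ?_ hα.le
      have := abs_add_le b (a - b)
      rwa [add_sub_cancel] at this
    have h1 := key a b
    have h2 := key b a
    rw [abs_sub_comm b a] at h2
    rw [abs_le]; constructor <;> linarith
  · refine ⟨α * R ^ (α - 1), by positivity, fun a b ha hb => ?_⟩
    rw [min_eq_right h, Real.rpow_one]
    have key := (convex_Icc (0:ℝ) R).norm_image_sub_le_of_norm_hasDerivWithin_le
      (f := fun y : ℝ => y ^ α) (f' := fun y => α * y ^ (α - 1)) (C := α * R ^ (α - 1))
      (x := |b|) (y := |a|)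
      (fun y _ => (Real.hasDerivAt_rpow_const (Or.inr h)).hasDerivWithinAt)
      (fun y hy => by
        rw [Real.norm_eq_abs, abs_of_nonneg (by have := hy.1; positivity)]
        have h1 := hy.1
        have h2 := hy.2
        gcongr) ⟨abs_nonneg _, hb⟩ ⟨abs_nonneg _, ha⟩
    rw [Real.norm_eq_abs, Real.norm_eq_abs] at key
    refine key.trans ?_
    exact mul_le_mul_of_nonneg_left (abs_abs_sub_abs_le_abs_sub a b) (by positivity)

end Scalar

section Nonlin

variable {N : ℕ}

lemma pw_cont (α : ℝ) (hα : 0 < α) : Continuous fun p : ℝ × ℝ => |p.1| ^ α * p.1 :=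
  ((continuous_fst.abs).rpow_const fun _ => Or.inr hα.le).mul continuous_fst

lemma pw'_cont (α : ℝ) (hα : 0 < α) : Continuous fun p : ℝ × ℝ => (α + 1) * |p.1| ^ α * p.2 :=
  (continuous_const.mul ((continuous_fst.abs).rpow_const fun _ => Or.inr hα.le)).mul continuous_snd

/-- The nonlinearity. -/
noncomputable def FN (α : ℝ) (hα : 0 < α) (f : Cbu N) : Cbu N := nem _ (pw_cont α hα) (f, f)

/-- The linearised nonlinearity. -/
noncomputable def GN (α : ℝ) (hα : 0 < α) (f g : Cbu N) : Cbu N := nem _ (pw'_cont α hα) (f, g)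

lemma FN_apply (α : ℝ) (hα : 0 < α) (f : Cbu N) (x : EE N) :
    (FN α hα f).1 x = |f.1 x| ^ α * f.1 x := rfl

lemma GN_apply (α : ℝ) (hα : 0 < α) (f g : Cbu N) (x : EE N) :
    (GN α hα f g).1 x = (α + 1) * |f.1 x| ^ α * g.1 x := rfl

lemma FN_cont (α : ℝ) (hα : 0 < α) : Continuous (FN (N := N) α hα) :=
  (nem_cont _ (pw_cont α hα)).comp (continuous_id.prodMk continuous_id)

lemma GN_cont (α : ℝ) (hα : 0 < α) : Continuous fun p : Cbu N × Cbu N => GN (N := N) α hα p.1 p.2 :=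
  nem_cont _ (pw'_cont α hα)

lemma FN_hasD (α : ℝ) (hα : 0 < α) {v : EE N} {f g : Cbu N} (h : (TC N).HasD v f g) :
    (TC N).HasD v (FN α hα f) (GN α hα f g) := by
  refine HasD_of_pt fun x => ?_
  have h1 := HasD_pt h x
  have h2 : HasDerivAt (fun y : ℝ => |y| ^ α * y) ((α + 1) * |f.1 x| ^ α) (f.1 (x + (0:ℝ) • v)) := by
    rw [zero_smul, add_zero]; exact hasDerivAt_pw α hα _
  exact h2.comp (h := fun s : ℝ => f.1 (x + s • v)) 0 h1

lemma TC_norm_le {f : Cbu N} {C : ℝ} {a : EE N} (h : ‖(TC N).τ a f - f‖ ≤ C) (x : EE N) :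
    |f.1 (x + a) - f.1 x| ≤ C := by
  have h2 := Cbu_abs_le ((TC N).τ a f - f) x
  exact h2.trans h

lemma GN_holder (α : ℝ) (hα : 0 < α) (R L : ℝ) (hR : 0 ≤ R) (hL : 0 ≤ L) :
    ∃ C, 0 ≤ C ∧ ∀ f g : Cbu N, ‖f‖ ≤ R → ‖g‖ ≤ R → (∀ a, ‖(TC N).τ a f - f‖ ≤ L * ‖a‖) →
      (∀ a, ‖(TC N).τ a g - g‖ ≤ L * ‖a‖) →
      ∀ a, ‖(TC N).τ a (GN α hα f g) - GN α hα f g‖ ≤ C * (‖a‖ + ‖a‖ ^ (min α 1)) := by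
  obtain ⟨C, hC, h⟩ := pw_holder α hα R hR
  set β := min α 1 with hβ
  have hβ0 : 0 < β := lt_min hα one_pos
  refine ⟨(α + 1) * (C * L ^ β * R) + (α + 1) * R ^ α * L, by positivity, ?_⟩
  intro f g hf hg hfL hgL a
  refine Cbu_norm_le (by positivity) fun x => ?_
  have e : ((TC N).τ a (GN α hα f g) - GN α hα f g).1 x =
    (α + 1) * |f.1 (x + a)| ^ α * g.1 (x + a) - (α + 1) * |f.1 x| ^ α * g.1 x := rfl
  rw [e]
  have hfx := fun x => (Cbu_abs_le f x).trans hf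
  have hgx := fun x => (Cbu_abs_le g x).trans hg
  have h1 : |(|f.1 (x + a)| ^ α - |f.1 x| ^ α)| ≤ C * (L ^ β * ‖a‖ ^ β) := by
    refine (h _ _ (hfx _) (hfx _)).trans ?_
    rw [← Real.mul_rpow hL (norm_nonneg a)]
    gcongr
    exact TC_norm_le (hfL a) x
  have h2 := TC_norm_le (hgL a) x
  have h3 : |f.1 x| ^ α ≤ R ^ α := Real.rpow_le_rpow (abs_nonneg _) (hfx x) hα.le
  have h4 : (α + 1) * |f.1 (x + a)| ^ α * g.1 (x + a) - (α + 1) * |f.1 x| ^ α * g.1 x =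
    (α + 1) * ((|f.1 (x + a)| ^ α - |f.1 x| ^ α) * g.1 (x + a)) +
      (α + 1) * |f.1 x| ^ α * (g.1 (x + a) - g.1 x) := by ring
  rw [h4]
  refine (abs_add_le _ _).trans ?_
  have h5 : 0 ≤ |f.1 x| ^ α := by positivity
  have hα1 : 0 ≤ α + 1 := by linarith
  rw [abs_mul, abs_mul, abs_mul, abs_mul, abs_of_nonneg hα1, abs_of_nonneg h5]
  calc _ ≤ (α + 1) * (C * (L ^ β * ‖a‖ ^ β) * R) + (α + 1) * R ^ α * (L * ‖a‖) := by
        gcongr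
        exact hgx _
    _ = (α + 1) * (C * L ^ β * R) * ‖a‖ ^ β + (α + 1) * R ^ α * L * ‖a‖ := by ring
    _ ≤ ((α + 1) * (C * L ^ β * R) + (α + 1) * R ^ α * L) * ‖a‖ ^ β +
        ((α + 1) * (C * L ^ β * R) + (α + 1) * R ^ α * L) * ‖a‖ := by
        gcongr
        · have : 0 ≤ (α + 1) * R ^ α * L := by positivity
          linarith
        · have : 0 ≤ (α + 1) * (C * L ^ β * R) := by positivity
          linarith
    _ = _ := by ring

end Nonlin

section Space

variable {N : ℕ}

/-- The gradient functional. -/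
noncomputable def gradL (g : Fin N → ℝ) : EE N →L[ℝ] ℝ :=
  ∑ i, g i • (EuclideanSpace.proj i : EE N →L[ℝ] ℝ)

lemma gradL_apply (g : Fin N → ℝ) (v : EE N) : gradL g v = ∑ i, g i * v i := by
  simp [gradL]

lemma HasD_fderiv {f : Cbu N} {g : Fin N → Cbu N}
    (h : ∀ i, (TC N).HasD (EuclideanSpace.single i (1:ℝ)) f (g i)) (x : EE N) :
    HasFDerivAt (fun y => f.1 y) (gradL fun i => (g i).1 x) x := by
  have hlip : LipschitzWith (Real.toNNReal (∑ i, ‖g i‖)) (fun y => f.1 y) := by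
    refine LipschitzWith.of_dist_le_mul fun y z => ?_
    rw [Real.coe_toNNReal _ (Finset.sum_nonneg fun i _ => norm_nonneg _), Real.dist_eq, dist_eq_norm]
    have := TC_norm_le (TG.HasD.lip h (y - z)) z
    rwa [add_sub_cancel] at this
  refine hlip.hasFDerivAt_of_hasLineDerivAt_of_closure (s := univ) (by simp) fun v _ => ?_
  have h1 := HasD_pt (TG.HasD.all_dir h v) x
  unfold HasLineDerivAt
  refine h1.congr_deriv ?_
  rw [gradL_apply, ← evC_apply, map_sum]
  refine Finset.sum_congr rfl fun i _ => ?_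
  rw [map_smul, evC_apply, smul_eq_mul, mul_comm]

lemma fderiv_of_HasD {f : Cbu N} {g : Fin N → Cbu N}
    (h : ∀ i, (TC N).HasD (EuclideanSpace.single i (1:ℝ)) f (g i)) :
    fderiv ℝ (fun y => f.1 y) = fun x => gradL fun i => (g i).1 x :=
  funext fun x => (HasD_fderiv h x).fderiv

lemma gradL_single (g : Fin N → ℝ) (i : Fin N) : gradL g (EuclideanSpace.single i (1:ℝ)) = g i := by
  rw [gradL_apply]
  simp

lemma contDiff_two_of_HasD {f : Cbu N} {g : Fin N → Cbu N} {w : Fin N → Fin N → Cbu N}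
    (h : ∀ i, (TC N).HasD (EuclideanSpace.single i (1:ℝ)) f (g i))
    (h' : ∀ i j, (TC N).HasD (EuclideanSpace.single j (1:ℝ)) (g i) (w i j)) :
    ContDiff ℝ 2 (fun y => f.1 y) ∧ ∀ x i j, iteratedFDeriv ℝ 2 (fun y => f.1 y) x
      ![EuclideanSpace.single i (1:ℝ), EuclideanSpace.single j (1:ℝ)] = (w j i).1 x := by
  have hg1 : ∀ i, ContDiff ℝ 1 (fun y => (g i).1 y) := by
    intro i
    rw [contDiff_one_iff_fderiv]
    refine ⟨fun x => (HasD_fderiv (h' i) x).differentiableAt, ?_⟩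
    rw [fderiv_of_HasD (h' i)]
    unfold gradL
    refine continuous_finsetSum _ fun j _ => ?_
    exact (w i j).1.continuous.smul continuous_const
  constructor
  · rw [show (2 : WithTop ℕ∞) = 1 + 1 by norm_num, contDiff_succ_iff_fderiv]
    refine ⟨fun x => (HasD_fderiv h x).differentiableAt, by simp, ?_⟩
    rw [fderiv_of_HasD h]
    unfold gradL
    refine ContDiff.sum fun j _ => ?_
    exact (hg1 j).smul contDiff_const
  · intro x i j
    rw [iteratedFDeriv_two_apply, fderiv_of_HasD h]
    have h1 : HasFDerivAt (fun x => gradL fun i => (g i).1 x)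
      (∑ k, (gradL fun l => (w k l).1 x).smulRight (EuclideanSpace.proj k : EE N →L[ℝ] ℝ)) x := by
      have h2 : HasFDerivAt (fun x => ∑ k, (g k).1 x • (EuclideanSpace.proj k : EE N →L[ℝ] ℝ))
          (∑ k, (gradL fun l => (w k l).1 x).smulRight (EuclideanSpace.proj k : EE N →L[ℝ] ℝ)) x :=
        HasFDerivAt.fun_sum fun k _ =>
          (HasD_fderiv (h' k) x).smul_const (EuclideanSpace.proj k : EE N →L[ℝ] ℝ)
      exact h2
    rw [h1.fderiv]
    simp only [Matrix.cons_val_zero, Matrix.cons_val_one, _root_.sum_apply,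
      ContinuousLinearMap.smulRight_apply, gradL_single]
    simp

end Space

section Core

variable {N : ℕ}

lemma clamp_ex {X : Type*} [NormedAddCommGroup X] {g : ℝ → X} {c T : ℝ} (hc : c ≤ T)
    (hg : ContinuousOn g (Icc c T)) :
    ∃ g' : ℝ → X, Continuous g' ∧ (∀ t ∈ Icc c T, g' t = g t) ∧ (∃ M, ∀ t, ‖g' t‖ ≤ M) ∧
      ∀ t, ∃ s ∈ Icc c T, g' t = g s := by
  have hcont : Continuous fun t : ℝ => g (projIcc c T hc t) :=
    (continuousOn_iff_continuous_domRestrict.1 hg).comp continuous_projIcc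
  refine ⟨fun t => g (projIcc c T hc t), hcont, fun t ht => ?_, ?_, fun t => ⟨_, (projIcc c T hc t).2, rfl⟩⟩
  · simp only; rw [projIcc_of_mem hc ht]
  · obtain ⟨M, hM⟩ := isCompact_Icc.exists_bound_of_continuousOn hg
    exact ⟨M, fun t => hM _ (projIcc c T hc t).2⟩

/-- Directional derivative as a function. -/
noncomputable def dv (v : EE N) (f : Cbu N) : Cbu N := deriv (fun s : ℝ => (TC N).τ (s • v) f) 0

lemma dv_eq {v : EE N} {f g : Cbu N} (h : (TC N).HasD v f g) : dv v f = g := HasDerivAt.deriv h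

lemma glue {f : ℝ → Cbu N} {T : ℝ} {v : EE N}
    (h : ∀ c, 0 < c → c < T → ∃ g : ℝ → Cbu N, (∀ t ∈ Ioc c T, (TC N).HasD v (f t) (g t)) ∧
      ∀ t, c < t → ContinuousAt g t) :
    (∀ t ∈ Ioc 0 T, (TC N).HasD v (f t) (dv v (f t))) ∧
      ContinuousOn (fun t => dv v (f t)) (Ioc 0 T) := by
  constructor
  · intro t ht
    obtain ⟨g, hg, -⟩ := h (t/2) (by linarith [ht.1]) (by linarith [ht.1, ht.2])
    have := hg t ⟨by linarith [ht.1], ht.2⟩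
    rw [dv_eq this]; exact this
  · intro t ht
    obtain ⟨g, hg, hc⟩ := h (t/2) (by linarith [ht.1]) (by linarith [ht.1, ht.2])
    have h1 := (hc t (by linarith [ht.1])).continuousWithinAt (s := Ioc 0 T)
    refine h1.congr_of_eventuallyEq ?_ ?_
    · have : ∀ᶠ s in 𝓝[Ioc 0 T] t, s ∈ Ioc 0 T ∩ Ioi (t/2) :=
        inter_mem self_mem_nhdsWithin (nhdsWithin_le_nhds (Ioi_mem_nhds (by linarith [ht.1])))
      filter_upwards [this] with s hs
      exact dv_eq (hg s ⟨hs.2, hs.1.2⟩)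
    · exact dv_eq (hg t ⟨by linarith [ht.1], ht.2⟩)

lemma GN_contOn (α : ℝ) (hα : 0 < α) {f g : ℝ → Cbu N} {s : Set ℝ} (hf : ContinuousOn f s)
    (hg : ContinuousOn g s) : ContinuousOn (fun t => GN α hα (f t) (g t)) s :=
  Continuous.comp_continuousOn (g := fun p : Cbu N × Cbu N => GN (N := N) α hα p.1 p.2)
    (f := fun t => (f t, g t)) (GN_cont α hα) (hf.prodMk hg)

/-- Standard basis vector. -/
noncomputable abbrev bv (i : Fin N) : EE N := EuclideanSpace.single i (1:ℝ)

set_option maxHeartbeats 400000 in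
theorem core {α T : ℝ} (hα : 0 < α) (hT : 0 < T) {u : ℝ → Cbu N} (hu : Continuous u)
    {M : ℝ} (hM : ∀ s, ‖FN α hα (u s)‖ ≤ M)
    (hm : (TC N).Mild 0 T u (fun s => FN α hα (u s))) :
    ∃ (V : Fin N → ℝ → Cbu N) (W : Fin N → Fin N → ℝ → Cbu N) (V' : Fin N → ℝ → Cbu N),
      (∀ i, ∀ t ∈ Ioc 0 T, (TC N).HasD (bv i) (u t) (V i t)) ∧
      (∀ i j, ∀ t ∈ Ioc 0 T, (TC N).HasD (bv j) (V i t) (W i j t)) ∧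
      (∀ i j, ContinuousOn (W i j) (Ioc 0 T)) ∧
      (∀ t ∈ Ioo 0 T, HasDerivAt u (∑ i, W i i t + FN α hα (u t)) t) ∧
      (∀ i, ∀ t ∈ Ioo 0 T, HasDerivAt (V i) (V' i t) t) ∧
      (∀ i, ContinuousOn (V' i) (Ioo 0 T)) := by
  have hG : Continuous fun s => FN α hα (u s) := (FN_cont α hα).comp hu
  obtain ⟨V, hVg⟩ : ∃ V : Fin N → ℝ → Cbu N, ∀ i, (∀ t ∈ Ioc 0 T,
      (TC N).HasD (bv i) (u t) (V i t)) ∧ ContinuousOn (V i) (Ioc 0 T) := by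
    refine ⟨fun i t => dv (bv i) (u t), fun i => ?_⟩
    refine glue (f := u) (v := bv i) fun c hc hcT => ?_
    obtain ⟨h1, h2⟩ := hm.hasD hG hM (bv i)
    exact ⟨_, fun t ht => h1 t ⟨hc.trans ht.1, ht.2⟩, fun t ht => h2 t (hc.trans ht)⟩
  have hsub : ∀ {c}, 0 < c → Icc c T ⊆ Ioc 0 T := fun hc t ht => ⟨hc.trans_le ht.1, ht.2⟩
  have hcontGN : ∀ i, ContinuousOn (fun t => GN α hα (u t) (V i t)) (Ioc 0 T) := fun i =>
    GN_contOn α hα hu.continuousOn (hVg i).2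
  have hmV : ∀ i c, 0 < c → c < T → ∃ H : ℝ → Cbu N, Continuous H ∧
      (∀ t ∈ Icc c T, H t = GN α hα (u t) (V i t)) ∧ (∃ M, ∀ t, ‖H t‖ ≤ M) ∧
      (∀ t, ∃ s ∈ Icc c T, H t = GN α hα (u s) (V i s)) ∧ (TC N).Mild c T (V i) H := by
    intro i c hc hcT
    obtain ⟨H, h1, h2, h3, h4⟩ := clamp_ex hcT.le ((hcontGN i).mono (hsub hc))
    refine ⟨H, h1, h2, h3, h4, ?_⟩
    refine (hm.restart hG hc.le hcT.le).deriv_mild hG h1 (bv i) hcT.le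
      (fun t ht => (hVg i).1 t (hsub hc ht)) fun t ht => ?_
    rw [h2 t ht]
    exact FN_hasD α hα ((hVg i).1 t (hsub hc ht))
  obtain ⟨W, hWg⟩ : ∃ W : Fin N → Fin N → ℝ → Cbu N, ∀ i j, (∀ t ∈ Ioc 0 T,
      (TC N).HasD (bv j) (V i t) (W i j t)) ∧ ContinuousOn (W i j) (Ioc 0 T) := by
    refine ⟨fun i j t => dv (bv j) (V i t), fun i j => ?_⟩
    refine glue (f := V i) (v := bv j) fun c hc hcT => ?_
    obtain ⟨H, h1, h2, ⟨K, hK⟩, h4, h5⟩ := hmV i c hc hcT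
    obtain ⟨h6, h7⟩ := h5.hasD h1 hK (bv j)
    exact ⟨_, h6, h7⟩
  -- third derivatives
  obtain ⟨Z, hZg⟩ : ∃ Z : Fin N → Fin N → Fin N → ℝ → Cbu N, ∀ i j k, (∀ t ∈ Ioc 0 T,
      (TC N).HasD (bv k) (W i j t) (Z i j k t)) ∧ ContinuousOn (Z i j k) (Ioc 0 T) := by
    refine ⟨fun i j k t => dv (bv k) (W i j t), fun i j k => ?_⟩
    refine glue (f := W i j) (v := bv k) fun c hc hcT => ?_
    obtain ⟨H, h1, h2, ⟨K, hK⟩, h4, h5⟩ := hmV i c hc hcT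
    -- uniform bounds
    have hmc : ContinuousOn (fun t => ‖u t‖ + ∑ i, ‖V i t‖ + ∑ i, ∑ j, ‖W i j t‖) (Icc c T) := by
      refine (hu.norm.continuousOn.add (continuousOn_finsetSum _ fun i _ => ?_)).add
        (continuousOn_finsetSum _ fun i _ => continuousOn_finsetSum _ fun j _ => ?_)
      · exact ((hVg i).2.mono (hsub hc)).norm
      · exact ((hWg i j).2.mono (hsub hc)).norm
    obtain ⟨R, hR⟩ := isCompact_Icc.exists_bound_of_continuousOn hmc
    have hR' : ∀ t ∈ Icc c T, ‖u t‖ + ∑ i, ‖V i t‖ + ∑ i, ∑ j, ‖W i j t‖ ≤ R := fun t ht =>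
      (le_abs_self _).trans (hR t ht)
    have n1 : ∀ t, 0 ≤ ∑ i, ‖V i t‖ := fun t => Finset.sum_nonneg fun _ _ => norm_nonneg _
    have n2 : ∀ i t, 0 ≤ ∑ j, ‖W i j t‖ := fun i t => Finset.sum_nonneg fun _ _ => norm_nonneg _
    have n3 : ∀ t, 0 ≤ ∑ i, ∑ j, ‖W i j t‖ := fun t => Finset.sum_nonneg fun i _ => n2 i t
    have hR0 : 0 ≤ R := (norm_nonneg _).trans (hR c ⟨le_rfl, hcT.le⟩)
    obtain ⟨C, hC, hhol⟩ := GN_holder (N := N) α hα R R hR0 hR0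
    have hH : ∀ s x, ‖(TC N).τ x (H s) - H s‖ ≤ C * (‖x‖ + ‖x‖ ^ (min α 1)) := by
      intro s x
      obtain ⟨s', hs', e⟩ := h4 s
      rw [e]
      have hb := hR' s' hs'
      have hVi : ‖V i s'‖ ≤ ∑ i, ‖V i s'‖ :=
        Finset.single_le_sum (f := fun i => ‖V i s'‖) (fun _ _ => norm_nonneg _) (Finset.mem_univ i)
      have hWi : ∑ j, ‖W i j s'‖ ≤ ∑ i, ∑ j, ‖W i j s'‖ :=
        Finset.single_le_sum (f := fun i => ∑ j, ‖W i j s'‖) (fun i _ => n2 i s') (Finset.mem_univ i)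
      have q1 := n1 s'
      have q2 := n2 i s'
      have q3 := n3 s'
      have q4 := norm_nonneg (u s')
      refine hhol _ _ (by linarith) (by linarith) (fun a => ?_) (fun a => ?_) x
      · refine (TG.HasD.lip (fun i => (hVg i).1 s' (hsub hc hs')) a).trans ?_
        gcongr; linarith
      · refine (TG.HasD.lip (fun j => (hWg i j).1 s' (hsub hc hs')) a).trans ?_
        gcongr; linarith
    obtain ⟨h6, h7⟩ := h5.hasD h1 hK (bv j)
    obtain ⟨h8, h9⟩ := TG.Mild.hasDD (A := TC N) (a := c) (b := T) (u := V i) h1 hK hC (lt_min hα one_pos)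
      (min_le_right _ _) hH (bv j) (bv k)
    refine ⟨_, fun t ht => ?_, h9⟩
    have e := ((hWg i j).1 t ⟨hc.trans ht.1, ht.2⟩).unique (h6 t ht)
    rw [e]
    exact h8 t ht
  refine ⟨V, W, fun i t => ∑ j, Z i j j t + GN α hα (u t) (V i t), fun i => (hVg i).1,
    fun i j => (hWg i j).1, fun i j => (hWg i j).2, ?_, ?_, ?_⟩
  · intro t ht
    exact hm.hasDerivAt hG hu.continuousOn (fun i t ht => (hVg i).1 t (Ioo_subset_Ioc_self ht))
      (fun i t ht => (hWg i i).1 t (Ioo_subset_Ioc_self ht))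
      (fun i => (hWg i i).2.mono Ioo_subset_Ioc_self) t ht
  · intro i t ht
    have hc : 0 < t/2 := by linarith [ht.1]
    have hs2 : Ioo (t/2) T ⊆ Ioc 0 T := fun s hs => ⟨hc.trans hs.1, hs.2.le⟩
    obtain ⟨H, h1, h2, ⟨K, hK⟩, h4, h5⟩ := hmV i (t/2) hc (by linarith [ht.1, ht.2])
    have := h5.hasDerivAt h1 ((hVg i).2.mono (hsub hc)) (V := W i) (W := fun j => Z i j j)
      (fun j t ht => (hWg i j).1 t (hs2 ht))
      (fun j t ht => (hZg i j j).1 t (hs2 ht))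
      (fun j => (hZg i j j).2.mono hs2) t ⟨by linarith [ht.1], ht.2⟩
    rw [h2 t ⟨by linarith [ht.1], ht.2.le⟩] at this
    exact this
  · intro i
    exact ((continuousOn_finsetSum _ fun j _ => (hZg i j j).2).add (hcontGN i)).mono
      Ioo_subset_Ioc_self

end Core

section Final

variable {N : ℕ}

/-- Inclusion into bounded continuous functions. -/
noncomputable def coeC : Cbu N →L[ℝ] BoundedContinuousFunction (EE N) ℝ :=
  LinearMap.mkContinuous
    { toFun := fun f : Cbu N => f.1
      map_add' := fun _ _ => rfl
      map_smul' := fun _ _ => rfl } 1 (fun f => by rw [one_mul]; exact le_refl ‖f‖)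

lemma coeC_apply (f : Cbu N) : coeC f = f.1 := rfl

lemma coeC_pt (f : Cbu N) (x : EE N) : coeC f x = f.1 x := rfl

lemma coeC_uc (f : Cbu N) : UniformContinuous (coeC f) := f.2

lemma coeC_deriv {f : ℝ → Cbu N} {f' : Cbu N} {t : ℝ} (h : HasDerivAt f f' t) :
    HasDerivAt (fun t => coeC (f t)) (coeC f') t :=
  (coeC (N := N)).hasFDerivAt.comp_hasDerivAt t h

lemma coeC_contOn {f : ℝ → Cbu N} {s : Set ℝ} (h : ContinuousOn f s) :
    ContinuousOn (fun t => coeC (f t)) s :=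
  (coeC (N := N)).continuous.comp_continuousOn h

/-- Reduction to the abstract setting. -/
lemma mild_of_pt {α T : ℝ} (hα : 0 < α) {U : ℝ → Cbu N} (hU : Continuous U)
    (heq : ∀ t ∈ Ioc 0 T, ∀ x, (U t).1 x =
      (∫ y, gaussK N t (x - y) * (U 0).1 y) +
        ∫ s in Ioo (0 : ℝ) t, ∫ y, gaussK N (t - s) (x - y) * (|(U s).1 y| ^ α * (U s).1 y)) :
    (TC N).Mild 0 T U (fun s => FN α hα (U s)) := by
  intro t ht
  have hG : Continuous fun s => FN α hα (U s) := (FN_cont α hα).comp hU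
  rcases ht.1.eq_or_lt with h | h
  · subst h
    rw [intervalIntegral.integral_same, add_zero, (TC N).S_zero _ (by simp)]
  · refine Cbu_ext fun x => ?_
    have hIntg : IntervalIntegrable (fun s => (TC N).S (t - s) (FN α hα (U s))) volume 0 t :=
      (TG.S_cont_duh hG t).intervalIntegrable _ _
    have e : ((TC N).S (t - 0) (U 0) + ∫ s in (0:ℝ)..t, (TC N).S (t - s) (FN α hα (U s))).1 x =
        ((TC N).S (t - 0) (U 0)).1 x + evC x (∫ s in (0:ℝ)..t, (TC N).S (t - s) (FN α hα (U s))) := rfl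
    rw [e, sub_zero, S_pt t h, heq t ⟨h, ht.2⟩ x,
      ← ContinuousLinearMap.intervalIntegral_comp_comm _ hIntg,
      intervalIntegral.integral_of_le h.le, integral_Ioc_eq_integral_Ioo]
    congr 1
    refine setIntegral_congr_fun measurableSet_Ioo fun s hs => ?_
    have := S_pt (t - s) (by linarith [hs.2]) (FN α hα (U s)) x
    simp only [FN_apply] at this
    simp only [evC_apply]
    exact this.symm

end Final

/-- Theorem C.1.  A mild solution `u ∈ C([0,T], C_{b,u}(ℝ^N))` of the
nonlinear heat equation is a classical solution: it is `C¹` in time with values in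
`C_{b,u}`, `C²` in space with `Δu(t,·) ∈ C_{b,u}` depending continuously on `t`, it
satisfies `∂_t u = Δu + |u|^α u` on `(0,T) × ℝ^N`, the first-order spatial derivatives are
`C¹` in time with values in `C_{b,u}`, and all second-order spatial derivatives are
continuous in time with values in `C_{b,u}`. -/
theorem stmt17 (N : ℕ) (hN : 1 ≤ N) (α T : ℝ) (hα : 0 < α) (hT : 0 < T)
    (u₀ : BoundedContinuousFunction (EuclideanSpace ℝ (Fin N)) ℝ)
    (hu₀uc : UniformContinuous u₀)
    (u : ℝ → BoundedContinuousFunction (EuclideanSpace ℝ (Fin N)) ℝ)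
    (hucont : ContinuousOn u (Icc 0 T))
    (huuc : ∀ t ∈ Icc 0 T, UniformContinuous (u t))
    (hu0 : u 0 = u₀)
    (heq : ∀ t ∈ Ioc 0 T, ∀ x, u t x =
      (∫ y, gaussK N t (x - y) * u₀ y) +
        ∫ s in Ioo (0 : ℝ) t, ∫ y, gaussK N (t - s) (x - y) * (|u s y| ^ α * u s y)) :
    -- (i) `t ↦ u(t)` is `C¹` from `(0,T)` into `C_{b,u}(ℝ^N)`, and
    -- (iii) `∂_t u = Δu + |u|^α u`
    (∃ u' : ℝ → BoundedContinuousFunction (EuclideanSpace ℝ (Fin N)) ℝ,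
      (∀ t ∈ Ioo 0 T, HasDerivAt u (u' t) t ∧ UniformContinuous (u' t)) ∧
      ContinuousOn u' (Ioo 0 T) ∧
      (∀ t ∈ Ioo 0 T, ∀ x, u' t x = lap N (fun y => u t y) x + |u t x| ^ α * u t x)) ∧
    -- (ii) `u(t,·)` is `C²` in `x` with `Δu(t,·) ∈ C_{b,u}(ℝ^N)` ...
    (∀ t ∈ Ioo 0 T, ContDiff ℝ 2 (fun x => u t x) ∧
      UniformContinuous (fun x => lap N (fun y => u t y) x) ∧
      ∃ b, ∀ x, |lap N (fun y => u t y) x| ≤ b) ∧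
    -- ... and `t ↦ Δu(t)` is continuous `(0,T) → C_{b,u}(ℝ^N)` in the supremum norm
    (∀ t ∈ Ioo 0 T, ∀ ε > (0 : ℝ), ∃ η > (0 : ℝ), ∀ s ∈ Ioo 0 T, |s - t| < η →
      ∀ x, |lap N (fun y => u s y) x - lap N (fun y => u t y) x| ≤ ε) ∧
    -- (iv) each `∂ᵢu` is `C¹` from `(0,T)` into `C_{b,u}(ℝ^N)` ...
    (∀ i : Fin N, ∃ g g' : ℝ → BoundedContinuousFunction (EuclideanSpace ℝ (Fin N)) ℝ,
      (∀ t ∈ Ioo 0 T, ∀ x,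
        g t x = fderiv ℝ (fun y => u t y) x (EuclideanSpace.single i 1)) ∧
      (∀ t ∈ Ioo 0 T, HasDerivAt g (g' t) t ∧ UniformContinuous (g t) ∧
        UniformContinuous (g' t)) ∧
      ContinuousOn g' (Ioo 0 T)) ∧
    -- ... and every second-order spatial derivative is in `C((0,T), C_{b,u}(ℝ^N))`
    (∀ i j : Fin N, ∃ D : ℝ → BoundedContinuousFunction (EuclideanSpace ℝ (Fin N)) ℝ,
      (∀ t ∈ Ioo 0 T, ∀ x, D t x = iteratedFDeriv ℝ 2 (fun y => u t y) x
        ![EuclideanSpace.single i 1, EuclideanSpace.single j 1]) ∧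
      (∀ t ∈ Ioo 0 T, UniformContinuous (D t)) ∧
      ContinuousOn D (Ioo 0 T)) := by
  -- the clamped solution with values in the Banach space
  obtain ⟨U, hUc, hUe, hUb⟩ : ∃ U : ℝ → Cbu N, Continuous U ∧ (∀ t ∈ Icc 0 T, (U t).1 = u t) ∧
      ∃ M, ∀ t, ‖FN α hα (U t)‖ ≤ M := by
    have hPc : Continuous fun t : ℝ => u (projIcc 0 T hT.le t) :=
      (continuousOn_iff_continuous_domRestrict.1 hucont).comp continuous_projIcc
    let U : ℝ → Cbu N := fun t => ⟨u (projIcc 0 T hT.le t), huuc _ (projIcc 0 T hT.le t).2⟩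
    have hU : Continuous U := by
      rw [Metric.continuous_iff] at hPc ⊢
      exact hPc
    have hUP : ∀ t, U t = U (projIcc 0 T hT.le t) := by
      intro t
      refine Subtype.ext ?_
      change u _ = u _
      rw [projIcc_of_mem hT.le (projIcc 0 T hT.le t).2]
    refine ⟨U, hU, fun t ht => ?_, ?_⟩
    · change u _ = u _
      rw [projIcc_of_mem hT.le ht]
    · obtain ⟨M, hM⟩ := (isCompact_Icc (a := (0:ℝ)) (b := T)).exists_bound_of_continuousOn
        ((FN_cont α hα).comp hU).continuousOn
      refine ⟨M, fun t => ?_⟩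
      rw [hUP t]
      exact hM _ (projIcc 0 T hT.le t).2
  obtain ⟨M, hM⟩ := hUb
  have hm : (TC N).Mild 0 T U (fun s => FN α hα (U s)) := by
    refine mild_of_pt hα hUc fun t ht x => ?_
    rw [hUe t ⟨ht.1.le, ht.2⟩, heq t ht x, hUe 0 ⟨le_rfl, hT.le⟩, hu0]
    congr 1
    refine setIntegral_congr_fun measurableSet_Ioo fun s hs => ?_
    rw [hUe s ⟨hs.1.le, hs.2.le.trans ht.2⟩]
  obtain ⟨V, W, V', hV, hW, hWc, hu', hV', hV'c⟩ := core hα hT hUc hM hm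
  have hsub : Ioo 0 T ⊆ Ioc 0 T := Ioo_subset_Ioc_self
  have hUf : ∀ t ∈ Ioo 0 T, (fun y => u t y) = fun y => (U t).1 y := by
    intro t ht
    rw [hUe t ⟨ht.1.le, ht.2.le⟩]
  have hC2 := fun t (ht : t ∈ Ioo 0 T) =>
    contDiff_two_of_HasD (fun i => hV i t (hsub ht)) (fun i j => hW i j t (hsub ht))
  have hlap : ∀ t ∈ Ioo 0 T, ∀ x, lap N (fun y => u t y) x = (∑ i, W i i t).1 x := by
    intro t ht x
    rw [hUf t ht, ← evC_apply, map_sum]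
    unfold lap
    refine Finset.sum_congr rfl fun i _ => ?_
    exact (hC2 t ht).2 x i i
  have hΔc : ContinuousOn (fun t => ∑ i, W i i t) (Ioo 0 T) :=
    continuousOn_finsetSum _ fun i _ => (hWc i i).mono hsub
  refine ⟨⟨fun t => coeC (∑ i, W i i t + FN α hα (U t)), fun t ht => ⟨?_, coeC_uc _⟩, ?_, ?_⟩, ?_, ?_,
    ?_, ?_⟩
  · refine (coeC_deriv (hu' t ht)).congr_of_eventuallyEq ?_
    filter_upwards [Ioo_mem_nhds ht.1 ht.2] with s hs
    exact (hUe s ⟨hs.1.le, hs.2.le⟩).symm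
  · exact coeC_contOn (hΔc.add ((FN_cont α hα).comp hUc).continuousOn)
  · intro t ht x
    rw [hlap t ht x, ← hUe t ⟨ht.1.le, ht.2.le⟩]
    rfl
  · intro t ht
    refine ⟨?_, ?_, ‖∑ i, W i i t‖, fun x => ?_⟩
    · rw [hUf t ht]; exact (hC2 t ht).1
    · rw [funext (hlap t ht)]; exact Cbu_uc _
    · rw [hlap t ht]; exact Cbu_abs_le _ x
  · intro t ht ε hε
    obtain ⟨η, hη, h⟩ := Metric.continuousOn_iff.1 hΔc t ht ε hε
    refine ⟨η, hη, fun s hs hst x => ?_⟩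
    have h1 := h s hs (by rw [Real.dist_eq]; exact hst)
    rw [dist_eq_norm] at h1
    rw [hlap s hs, hlap t ht]
    exact (Cbu_abs_le (∑ i, W i i s - ∑ i, W i i t) x).trans h1.le
  · intro i
    refine ⟨fun t => coeC (V i t), fun t => coeC (V' i t), fun t ht x => ?_,
      fun t ht => ⟨coeC_deriv (hV' i t ht), coeC_uc _, coeC_uc _⟩, coeC_contOn (hV'c i)⟩
    rw [hUf t ht, fderiv_of_HasD (fun i => hV i t (hsub ht)), gradL_single, coeC_pt]
  · intro i j
    refine ⟨fun t => coeC (W j i t), fun t ht x => ?_, fun t ht => coeC_uc _,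
      coeC_contOn ((hWc j i).mono hsub)⟩
    rw [hUf t ht, (hC2 t ht).2 x i j, coeC_pt]
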